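/- Let m = 2, D = {0,1}, and let S = Γ(1/2, 4·5^{−5/4}) ∪ {(γ,λ) ∈ Γ(1/2,1) : γ < 0.649}, V = {(γ,λ) : 0 < γ < λ < 1 and (γ^k, λ^k) ∈ S for some integer k ≥ 2}, and U = S ∪ V. Then for Lebesgue-almost every (γ,λ) ∈ U the measure μ_{γ,λ} is absolutely continuous with respect to Lebesgue measure on ℝ², and for Lebesgue-almost every (γ,λ) ∈ V it is absolutely continuous with a continuous density; in particular, for a.e. (γ,λ) ∈ V the set K_{γ,λ} has nonempty interior. -/

import Mathlib

open MeasureTheory Filter Set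
open scoped ENNReal Topology

noncomputable section

/-- The self-affine set `K_{γ,λ}` for a digit set `d : Fin m → ℝ`. -/
def Kaff (m : ℕ) (d : Fin m → ℝ) (g l : ℝ) : Set (ℝ × ℝ) :=
  {p | ∃ ω : ℕ → Fin m, p = (∑' n, d (ω n) * g ^ n, ∑' n, d (ω n) * l ^ n)}

/-- `Γ(a,b) = {(γ,λ) : 0 < γ < λ < 1, 1/m < λ, a < γλ < b}`. -/
def Gamma (m : ℕ) (a b : ℝ) : Set (ℝ × ℝ) :=
  {p | 0 < p.1 ∧ p.1 < p.2 ∧ p.2 < 1 ∧ 1 / (m : ℝ) < p.2 ∧ a < p.1 * p.2 ∧ p.1 * p.2 < b}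

/-- `ρ` is the Bernoulli product measure with weights `p`. -/
def IsBernoulliWith {α : Type*} [MeasurableSpace α] (p : α → ℝ≥0∞)
    (ρ : Measure (ℕ → α)) : Prop :=
  IsProbabilityMeasure ρ ∧
    ∀ (n : ℕ) (w : Fin n → α), ρ {ω | ∀ i : Fin n, ω i.1 = w i} = ∏ i, p (w i)

/-- `Π_{γ,λ}(ω) = ∑ₙ d(ωₙ)(γⁿ, λⁿ)`. -/
def PiTwo (m : ℕ) (d : Fin m → ℝ) (g l : ℝ) (ω : ℕ → Fin m) : ℝ × ℝ :=
  (∑' n, d (ω n) * g ^ n, ∑' n, d (ω n) * l ^ n)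

/-- The region `S = Γ(1/2, 4·5^{−5/4}) ∪ {(γ,λ) ∈ Γ(1/2,1) : γ < 0.649}`. -/
def regS : Set (ℝ × ℝ) :=
  Gamma 2 (1 / 2) (4 * (5 : ℝ) ^ (-(5 : ℝ) / 4)) ∪
    {q ∈ Gamma 2 (1 / 2) 1 | q.1 < 0.649}

/-- The region `V = {(γ,λ) : 0 < γ < λ < 1, (γ^k, λ^k) ∈ S for some k ≥ 2}`. -/
def regV : Set (ℝ × ℝ) :=
  {q | 0 < q.1 ∧ q.1 < q.2 ∧ q.2 < 1 ∧ ∃ k : ℕ, 2 ≤ k ∧ (q.1 ^ k, q.2 ^ k) ∈ regS}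


section general
variable {V : Type*} [NormedAddCommGroup V] [NormedSpace ℝ V] [FiniteDimensional ℝ V]
  [MeasurableSpace V] [BorelSpace V] [SecondCountableTopology V]

/-- pair correlation of a measure -/
def enrg (μ : Measure V) (r : ℝ) : ℝ≥0∞ := (μ.prod μ) {p | ‖p.1 - p.2‖ < r}

lemma en_cross (m μ : Measure V) [m.IsAddHaarMeasure] [IsFiniteMeasure μ] (r : ℝ) (y : V) :
    ∫⁻ x, μ (Metric.ball x r) * μ (Metric.ball (x - y) r) ∂m =
      ∫⁻ p, m {x | ‖p.1 - x‖ < r ∧ ‖p.2 - x + y‖ < r} ∂(μ.prod μ) := by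
  have hS : MeasurableSet {z : V × (V × V) | ‖z.2.1 - z.1‖ < r ∧ ‖z.2.2 - z.1 + y‖ < r} := by
    have ha : MeasurableSet {z : V × (V × V) | ‖z.2.1 - z.1‖ < r} :=
      measurableSet_lt (by fun_prop) (by fun_prop)
    have hb : MeasurableSet {z : V × (V × V) | ‖z.2.2 - z.1 + y‖ < r} :=
      measurableSet_lt (by fun_prop) (by fun_prop)
    exact ha.inter hb
  have h1 := Measure.prod_apply (μ := m) (ν := μ.prod μ) hS
  have h2 := Measure.prod_apply_symm (μ := m) (ν := μ.prod μ) hS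
  rw [h1] at h2
  refine Eq.trans ?_ h2
  congr 1
  ext x
  rw [← Measure.prod_prod]
  congr 1
  ext p
  simp [dist_eq_norm, sub_add]

lemma en_sq_le (m μ : Measure V) [m.IsAddHaarMeasure] [IsFiniteMeasure μ] (r : ℝ) :
    ∫⁻ x, μ (Metric.ball x r) * μ (Metric.ball x r) ∂m ≤ m (Metric.ball 0 r) * enrg μ (2 * r) := by
  have := en_cross m μ r 0
  simp only [sub_zero, add_zero] at this
  rw [this, enrg]
  have hS : MeasurableSet {p : V × V | ‖p.1 - p.2‖ < 2 * r} :=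
    measurableSet_lt (by fun_prop) (by fun_prop)
  rw [← lintegral_indicator_const hS]
  apply lintegral_mono
  intro p
  by_cases hp : ‖p.1 - p.2‖ < 2 * r
  · rw [indicator_of_mem (by exact hp)]
    rw [← Measure.addHaar_ball_center m p.1]
    apply measure_mono
    rintro x ⟨hx, -⟩
    simpa [dist_eq_norm, norm_sub_rev] using hx
  · rw [indicator_of_notMem (by exact hp)]
    simp only [nonpos_iff_eq_zero]
    convert measure_empty (μ := m)
    ext x
    simp only [mem_ofPred_eq, mem_empty_iff_false, iff_false, not_and]
    intro h1 h2
    apply hp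
    calc ‖p.1 - p.2‖ = ‖(p.1 - x) - (p.2 - x)‖ := by congr 1; abel
      _ ≤ _ := norm_sub_le _ _
      _ < _ := by linarith

lemma meas_ball_fun (μ : Measure V) [IsFiniteMeasure μ] (r : ℝ) :
    Measurable (fun x => μ (Metric.ball x r)) := by
  have hS : MeasurableSet {z : V × V | ‖z.2 - z.1‖ < r} :=
    measurableSet_lt (by fun_prop) (by fun_prop)
  convert measurable_measure_prodMk_left (ν := μ) hS using 2
  congr 1
  ext p
  simp [dist_eq_norm]

lemma en_shift [Nontrivial V] (m μ : Measure V) [m.IsAddHaarMeasure] [IsFiniteMeasure μ] {r : ℝ}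
    (hr : 0 < r) (y : V) :
    (μ.prod μ) {p | ‖p.1 - p.2 - y‖ < r} ≤
      ENNReal.ofReal (2 ^ Module.finrank ℝ V) * enrg μ (4 * r) := by
  have hb0 : m (Metric.ball 0 r) ≠ 0 := (Metric.measure_ball_pos m 0 hr).ne'
  have hbt : m (Metric.ball 0 r) ≠ ∞ := measure_ball_lt_top.ne
  have hS : MeasurableSet {p : V × V | ‖p.1 - p.2 - y‖ < r} :=
    measurableSet_lt (by fun_prop) (by fun_prop)
  have h1 : m (Metric.ball 0 r) * (μ.prod μ) {p | ‖p.1 - p.2 - y‖ < r} ≤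
      ∫⁻ x, μ (Metric.ball x (2 * r)) * μ (Metric.ball (x - y) (2 * r)) ∂m := by
    rw [en_cross, ← lintegral_indicator_const hS]
    apply lintegral_mono
    intro p
    by_cases hp : ‖p.1 - p.2 - y‖ < r
    · rw [indicator_of_mem (by exact hp)]
      rw [← Measure.addHaar_ball_center m p.1]
      apply measure_mono
      intro x hx
      have hx' : ‖p.1 - x‖ < r := by simpa [dist_eq_norm, norm_sub_rev] using hx
      refine ⟨by linarith, ?_⟩
      calc ‖p.2 - x + y‖ = ‖(p.1 - x) - (p.1 - p.2 - y)‖ := by congr 1; abel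
        _ ≤ _ := norm_sub_le _ _
        _ < _ := by linarith
    · rw [indicator_of_notMem (by exact hp)]
      exact zero_le
  have hm := meas_ball_fun μ (2 * r)
  have h2 : ∫⁻ x, μ (Metric.ball x (2 * r)) * μ (Metric.ball (x - y) (2 * r)) ∂m ≤
      ∫⁻ x, μ (Metric.ball x (2 * r)) * μ (Metric.ball x (2 * r)) ∂m := by
    set φ : V → ℝ≥0∞ := fun x => μ (Metric.ball x (2 * r)) with hφ
    have hsh : ∫⁻ x, φ (x - y) * φ (x - y) ∂m = ∫⁻ x, φ x * φ x ∂m :=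
      lintegral_sub_right_eq_self (μ := m) (fun x => φ x * φ x) y
    have h3 : 2 * ∫⁻ x, φ x * φ (x - y) ∂m ≤ 2 * ∫⁻ x, φ x * φ x ∂m := by
      calc 2 * ∫⁻ x, φ x * φ (x - y) ∂m = ∫⁻ x, 2 * (φ x * φ (x - y)) ∂m := by
            rw [lintegral_const_mul]
            exact hm.mul (hm.comp (measurable_id.sub_const y))
        _ ≤ ∫⁻ x, (φ x * φ x + φ (x - y) * φ (x - y)) ∂m := by
            apply lintegral_mono
            intro x
            have ha : φ x ≠ ∞ := measure_ne_top _ _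
            have hb : φ (x - y) ≠ ∞ := measure_ne_top _ _
            lift φ x to NNReal using ha with a
            lift φ (x - y) to NNReal using hb with b
            norm_cast
            rw [← NNReal.coe_le_coe]
            push_cast
            nlinarith [sq_nonneg ((a : ℝ) - b)]
        _ = ∫⁻ x, φ x * φ x ∂m + ∫⁻ x, φ (x - y) * φ (x - y) ∂m := by
            exact lintegral_add_left (hm.mul hm) _
        _ = _ := by rw [hsh, two_mul]
    exact (ENNReal.mul_le_mul_iff_right (by norm_num) (by norm_num)).1 h3
  have h3 := (h1.trans h2).trans (en_sq_le m μ (2 * r))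
  rw [Measure.addHaar_ball_mul m 0 (by norm_num) r, show 2 * (2 * r) = 4 * r by ring,
    mul_comm (ENNReal.ofReal _), mul_assoc] at h3
  exact (ENNReal.mul_le_mul_iff_right hb0 hbt).1 h3

end general


section general
variable {V : Type*} [NormedAddCommGroup V] [NormedSpace ℝ V] [FiniteDimensional ℝ V]
  [MeasurableSpace V] [BorelSpace V] [SecondCountableTopology V]

/-- radii `1/(k+1)` -/
def rk (k : ℕ) : ℝ := 1 / ((k : ℝ) + 1)

lemma rk_pos (k : ℕ) : 0 < rk k := by unfold rk; positivity

lemma rk_tendsto : Tendsto rk atTop (𝓝 0) := tendsto_one_div_add_atTop_nhds_zero_nat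

lemma crit_open (m μ : Measure V) [m.IsAddHaarMeasure] [IsFiniteMeasure μ] (C : ℝ≥0∞)
    (h : ∃ᶠ k : ℕ in atTop, enrg μ (2 * rk k) ≤ C * m (Metric.ball 0 (rk k)))
    (U : Set V) (hU : IsOpen U) (t : ℝ≥0∞) (ht : t ≠ 0) (ht' : t ≠ ∞) :
    μ U ≤ t * C + m U / t := by
  set b : ℕ → ℝ≥0∞ := fun k => m (Metric.ball 0 (rk k)) with hb
  have hb0 : ∀ k, b k ≠ 0 := fun k => (Metric.measure_ball_pos m 0 (rk_pos k)).ne'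
  have hbt : ∀ k, b k ≠ ∞ := fun k => measure_ball_lt_top.ne
  have hS : ∀ r : ℝ, MeasurableSet {z : V × V | z.2 ∈ U ∧ ‖z.2 - z.1‖ < r} := by
    intro r
    have h1 : MeasurableSet {z : V × V | ‖z.2 - z.1‖ < r} :=
      measurableSet_lt (by fun_prop) (by fun_prop)
    exact (measurable_snd hU.measurableSet).inter h1
  set ψ : ℕ → V → ℝ≥0∞ := fun k x => m (Prod.mk x ⁻¹' {z : V × V | z.2 ∈ U ∧ ‖z.2 - z.1‖ < rk k}) / b k
    with hψ
  have hψm : ∀ k, Measurable (ψ k) := fun k =>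
    (measurable_measure_prodMk_left (ν := m) (hS (rk k))).div_const _
  have h1 : μ U ≤ ∫⁻ x, liminf (fun k => ψ k x) atTop ∂μ := by
    rw [← lintegral_indicator_one hU.measurableSet]
    apply lintegral_mono
    intro x
    by_cases hx : x ∈ U
    · rw [indicator_of_mem hx]
      apply le_liminf_of_le (by isBoundedDefault)
      obtain ⟨ε, hε, hεU⟩ := Metric.isOpen_iff.1 hU x hx
      filter_upwards [rk_tendsto.eventually_lt_const hε] with k hk
      have : Prod.mk x ⁻¹' {z : V × V | z.2 ∈ U ∧ ‖z.2 - z.1‖ < rk k} = Metric.ball x (rk k) := by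
        ext y
        simp only [mem_preimage, mem_ofPred_eq, Metric.mem_ball, dist_eq_norm, and_iff_right_iff_imp]
        intro hy
        apply hεU
        simp [dist_eq_norm]; linarith
      simp only [hψ, this, Measure.addHaar_ball_center m x]
      simp only [Pi.one_apply]
      rw [ENNReal.div_self (hb0 k) (hbt k)]
    · rw [indicator_of_notMem hx]; exact zero_le
  refine h1.trans ((lintegral_liminf_le hψm).trans ?_)
  refine liminf_le_of_frequently_le (h.mono fun k hk => ?_) (by isBoundedDefault)
  -- Tonelli
  have h2 : ∫⁻ x, ψ k x ∂μ = ∫⁻ y in U, μ (Metric.ball y (rk k)) / b k ∂m := by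
    simp only [hψ, ENNReal.div_eq_inv_mul]
    rw [lintegral_const_mul _ (measurable_measure_prodMk_left (ν := m) (hS (rk k))),
      lintegral_const_mul _ (meas_ball_fun μ (rk k)), ← Measure.prod_apply (hS (rk k)),
      Measure.prod_apply_symm (hS (rk k)), ← lintegral_indicator hU.measurableSet]
    congr 2
    ext y
    by_cases hy : y ∈ U
    · rw [indicator_of_mem hy]
      congr 1
      ext x
      simp [hy, dist_eq_norm, norm_sub_rev]
    · rw [indicator_of_notMem hy]
      convert measure_empty (μ := μ)
      ext x
      simp [hy]
  rw [h2]
  have h3 : ∫⁻ y, (μ (Metric.ball y (rk k)) / b k) * (μ (Metric.ball y (rk k)) / b k) ∂m ≤ C := by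
    have h4 := (en_sq_le m μ (rk k)).trans (mul_le_mul_right hk _)
    calc ∫⁻ y, (μ (Metric.ball y (rk k)) / b k) * (μ (Metric.ball y (rk k)) / b k) ∂m
        = ∫⁻ y, ((b k)⁻¹ * (b k)⁻¹) * (μ (Metric.ball y (rk k)) * μ (Metric.ball y (rk k))) ∂m := by
          congr 1; ext y; simp only [ENNReal.div_eq_inv_mul]; ring
      _ = ((b k)⁻¹ * (b k)⁻¹) * ∫⁻ y, (μ (Metric.ball y (rk k)) * μ (Metric.ball y (rk k))) ∂m :=
          lintegral_const_mul _ ((meas_ball_fun μ _).mul (meas_ball_fun μ _))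
      _ ≤ ((b k)⁻¹ * (b k)⁻¹) * (b k * (C * b k)) := mul_le_mul_right h4 _
      _ = C * ((b k)⁻¹ * b k) * ((b k)⁻¹ * b k) := by ring
      _ = C := by rw [ENNReal.inv_mul_cancel (hb0 k) (hbt k)]; simp
  calc ∫⁻ y in U, μ (Metric.ball y (rk k)) / b k ∂m
      ≤ ∫⁻ y in U, (t * ((μ (Metric.ball y (rk k)) / b k) * (μ (Metric.ball y (rk k)) / b k)) + t⁻¹) ∂m := by
        apply lintegral_mono
        intro y
        have hne : μ (Metric.ball y (rk k)) / b k ≠ ∞ :=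
          ENNReal.div_ne_top (measure_ne_top _ _) (hb0 k)
        simp only
        lift t to NNReal using ht'
        lift μ (Metric.ball y (rk k)) / b k to NNReal using hne with s
        have ht0 : t ≠ 0 := by exact_mod_cast ht
        have htp : 0 < t := pos_iff_ne_zero.2 ht0
        rw [← ENNReal.coe_inv ht0]
        norm_cast
        rw [← NNReal.coe_le_coe]
        push_cast
        have htp' : (0 : ℝ) < t := by exact_mod_cast htp
        have hs : (0 : ℝ) ≤ s := s.2
        have : (t : ℝ)⁻¹ * t = 1 := inv_mul_cancel₀ htp'.ne'
        have hti : 0 < (t : ℝ)⁻¹ := by positivity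
        by_cases hc : (t : ℝ) * s ≤ 1
        · have : (s : ℝ) ≤ (t : ℝ)⁻¹ := by
            calc (s : ℝ) = (t : ℝ)⁻¹ * (t * s) := by field_simp
              _ ≤ (t : ℝ)⁻¹ * 1 := by gcongr
              _ = _ := mul_one _
          nlinarith [mul_nonneg htp'.le (mul_nonneg hs hs)]
        · push Not at hc
          nlinarith
    _ = ∫⁻ y in U, (t * ((μ (Metric.ball y (rk k)) / b k) * (μ (Metric.ball y (rk k)) / b k))) ∂m + t⁻¹ * m U := by
        rw [lintegral_add_right _ measurable_const]; simp
    _ ≤ ∫⁻ y, (t * ((μ (Metric.ball y (rk k)) / b k) * (μ (Metric.ball y (rk k)) / b k))) ∂m + t⁻¹ * m U := by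
        gcongr
        exact Measure.restrict_le_self
    _ ≤ t * C + t⁻¹ * m U := by
        have hmm : Measurable fun y => μ (Metric.ball y (rk k)) / b k * (μ (Metric.ball y (rk k)) / b k) :=
          ((meas_ball_fun μ _).div_const _).mul ((meas_ball_fun μ _).div_const _)
        rw [lintegral_const_mul _ hmm]
        gcongr
    _ = _ := by rw [ENNReal.div_eq_inv_mul]


lemma crit_ac (m μ : Measure V) [m.IsAddHaarMeasure] [IsFiniteMeasure μ] (C : ℝ≥0∞) (hC : C ≠ ∞)
    (h : ∃ᶠ k : ℕ in atTop, enrg μ (2 * rk k) ≤ C * m (Metric.ball 0 (rk k))) : μ ≪ m := by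
  refine Measure.AbsolutelyContinuous.mk fun A hA hA0 => ?_
  have key : ∀ t : NNReal, t ≠ 0 → μ A ≤ t * (C + 1) := by
    intro t ht
    obtain ⟨U, hAU, hUo, hUm⟩ := A.exists_isOpen_lt_of_lt (μ := m) (t * t : ℝ≥0∞)
      (by rw [hA0]; exact_mod_cast (mul_pos (pos_iff_ne_zero.2 ht) (pos_iff_ne_zero.2 ht)))
    have h1 := crit_open m μ C h U hUo t (by exact_mod_cast ht) (by simp)
    calc μ A ≤ μ U := measure_mono hAU
      _ ≤ _ := h1
      _ ≤ t * C + (t * t) / t := by gcongr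
      _ = t * (C + 1) := by
        rw [ENNReal.mul_div_cancel_right (by exact_mod_cast ht) (by simp)]; ring
  by_contra hne
  have hlim : Tendsto (fun t : NNReal => (t : ℝ≥0∞) * (C + 1)) (𝓝[>] 0) (𝓝 0) := by
    have : Tendsto (fun t : NNReal => (t : ℝ≥0∞) * (C + 1)) (𝓝 0) (𝓝 (((0 : NNReal) : ℝ≥0∞) * (C + 1))) := by
      apply ENNReal.Tendsto.mul_const
      · exact ENNReal.tendsto_coe.2 tendsto_id
      · right; simp [hC]
    simp only [ENNReal.coe_zero, zero_mul] at this
    exact this.mono_left nhdsWithin_le_nhds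
  have := ge_of_tendsto hlim (b := μ A) (by
    filter_upwards [self_mem_nhdsWithin] with t ht
    exact key t (ne_of_gt ht))
  exact hne (le_antisymm this zero_le)

lemma crit_L2 [Nontrivial V] (m μ : Measure V) [m.IsAddHaarMeasure] [IsFiniteMeasure μ] (C : ℝ≥0∞) (hC : C ≠ ∞)
    (h : ∃ᶠ k : ℕ in atTop, enrg μ (2 * rk k) ≤ C * m (Metric.ball 0 (rk k))) :
    ∃ g : V → ℝ≥0∞, Measurable g ∧ ∫⁻ x, g x * g x ∂m < ∞ ∧ μ = m.withDensity g := by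
  refine ⟨μ.rnDeriv m, Measure.measurable_rnDeriv _ _, ?_,
    (Measure.withDensity_rnDeriv_eq μ m (crit_ac m μ C hC h)).symm⟩
  set b : ℕ → ℝ≥0∞ := fun k => m (Metric.ball 0 (rk k)) with hb
  have hb0 : ∀ k, b k ≠ 0 := fun k => (Metric.measure_ball_pos m 0 (rk_pos k)).ne'
  have hbt : ∀ k, b k ≠ ∞ := fun k => measure_ball_lt_top.ne
  set K : ℝ≥0∞ := ENNReal.ofReal (2 ^ Module.finrank ℝ V) with hK
  have hbK : ∀ (k : ℕ) (x : V), b k = K * m (Metric.closedBall x (rk k / 2)) := by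
    intro k x
    have := Measure.addHaar_ball_mul m (0 : V) (r := 2) (by norm_num) (rk k / 2)
    rw [Measure.addHaar_closedBall_eq_addHaar_ball, Measure.addHaar_ball_center m x, hK, ← this]
    simp only [hb]
    congr 2
    ring
  set φ : ℕ → V → ℝ≥0∞ := fun k x => K * (μ (Metric.ball x (rk k)) / b k) with hφ
  have hφm : ∀ k, Measurable (φ k) := fun k => ((meas_ball_fun μ _).div_const _).const_mul _
  have hae : ∀ᵐ x ∂m, μ.rnDeriv m x * μ.rnDeriv m x ≤ liminf (fun k => φ k x * φ k x) atTop := by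
    filter_upwards [Besicovitch.ae_tendsto_rnDeriv μ m, Measure.rnDeriv_ne_top μ m] with x hx hxt
    have hr : Tendsto (fun k => rk k / 2) atTop (𝓝[>] 0) := by
      apply tendsto_nhdsWithin_of_tendsto_nhds_of_eventually_within
      · simpa using rk_tendsto.div_const 2
      · exact Eventually.of_forall fun k => by have := rk_pos k; simp only [mem_Ioi]; linarith
    have h1 := hx.comp hr
    have h2 := ENNReal.Tendsto.mul h1 (Or.inr hxt) h1 (Or.inr hxt)
    rw [← h2.liminf_eq]
    apply liminf_le_liminf
    · refine Eventually.of_forall fun k => ?_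
      have : μ (Metric.closedBall x (rk k / 2)) / m (Metric.closedBall x (rk k / 2)) ≤ φ k x := by
        have hK0 : K ≠ 0 := by simp [hK]
        have hKt : K ≠ ∞ := by simp [hK]
        simp only [hφ]
        rw [hbK k x, ← mul_div_assoc, ENNReal.mul_div_mul_left _ _ hK0 hKt]
        gcongr
        intro y hy
        have := rk_pos k
        simp only [Metric.mem_closedBall, Metric.mem_ball] at *
        linarith
      exact mul_le_mul' this this
    · isBoundedDefault
    · isBoundedDefault
  calc ∫⁻ x, μ.rnDeriv m x * μ.rnDeriv m x ∂m ≤ ∫⁻ x, liminf (fun k => φ k x * φ k x) atTop ∂m :=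
        lintegral_mono_ae hae
    _ ≤ liminf (fun k => ∫⁻ x, φ k x * φ k x ∂m) atTop :=
        lintegral_liminf_le fun k => (hφm k).mul (hφm k)
    _ ≤ K * K * C := by
        refine liminf_le_of_frequently_le (h.mono fun k hk => ?_) (by isBoundedDefault)
        have h4 := (en_sq_le m μ (rk k)).trans (mul_le_mul_right hk _)
        calc ∫⁻ y, φ k y * φ k y ∂m
            = ∫⁻ y, (K * K * ((b k)⁻¹ * (b k)⁻¹)) * (μ (Metric.ball y (rk k)) * μ (Metric.ball y (rk k))) ∂m := by
              congr 1; ext y; simp only [hφ, ENNReal.div_eq_inv_mul]; ring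
          _ = (K * K * ((b k)⁻¹ * (b k)⁻¹)) * ∫⁻ y, (μ (Metric.ball y (rk k)) * μ (Metric.ball y (rk k))) ∂m :=
              lintegral_const_mul _ ((meas_ball_fun μ _).mul (meas_ball_fun μ _))
          _ ≤ (K * K * ((b k)⁻¹ * (b k)⁻¹)) * (b k * (C * b k)) := mul_le_mul_right h4 _
          _ = K * K * C * ((b k)⁻¹ * b k) * ((b k)⁻¹ * b k) := by ring
          _ = K * K * C := by rw [ENNReal.inv_mul_cancel (hb0 k) (hbt k)]; simp
    _ < ∞ := by
        refine ENNReal.mul_lt_top (ENNReal.mul_lt_top ?_ ?_) hC.lt_top <;> simp [hK]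

end general

set_option linter.unusedSectionVars false

section general
variable {V : Type*} [NormedAddCommGroup V] [NormedSpace ℝ V] [FiniteDimensional ℝ V]
  [MeasurableSpace V] [BorelSpace V] [SecondCountableTopology V]

lemma memLp_toReal (m : Measure V) (g : V → ℝ≥0∞) (hg : Measurable g)
    (hg2 : ∫⁻ x, g x * g x ∂m < ∞) : MemLp (fun x => (g x).toReal) 2 m := by
  refine ⟨hg.ennreal_toReal.aestronglyMeasurable, ?_⟩
  rw [eLpNorm_lt_top_iff_lintegral_rpow_enorm_lt_top (by norm_num) (by norm_num)]
  refine lt_of_le_of_lt (lintegral_mono fun x => ?_) hg2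
  simp only [ENNReal.toReal_ofNat, ENNReal.rpow_ofNat]
  rw [sq]
  have : ‖(g x).toReal‖ₑ ≤ g x := by
    rw [Real.enorm_eq_ofReal ENNReal.toReal_nonneg]
    exact ENNReal.ofReal_toReal_le
  exact mul_le_mul' this this

lemma ae_ne_top_of_sq (m : Measure V) (g : V → ℝ≥0∞) (hg : Measurable g)
    (hg2 : ∫⁻ x, g x * g x ∂m < ∞) : ∀ᵐ x ∂m, g x ≠ ∞ := by
  filter_upwards [ae_lt_top (hg.mul hg) hg2.ne] with x hx h
  simp [h] at hx

lemma conv_density (m : Measure V) [m.IsAddHaarMeasure] (g h : V → ℝ≥0∞) (hg : Measurable g)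
    (hh : Measurable h) :
    ((m.withDensity g).prod (m.withDensity h)).map (fun p => p.1 + p.2) =
      m.withDensity (fun z => ∫⁻ y, g (z - y) * h y ∂m) := by
  ext A hA
  have hmap : Measurable (fun p : V × V => p.1 + p.2) := by fun_prop
  rw [Measure.map_apply hmap hA, prod_withDensity hg hh, withDensity_apply _ (hmap hA),
    withDensity_apply _ hA, ← lintegral_indicator (hmap hA), ← lintegral_indicator hA]
  have hm1 : Measurable (((fun p : V × V => p.1 + p.2) ⁻¹' A).indicator fun z => g z.1 * h z.2) :=
    (by fun_prop : Measurable fun z : V × V => g z.1 * h z.2).indicator (hmap hA)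
  rw [lintegral_prod_symm _ hm1.aemeasurable]
  have h1 : ∀ y, ∫⁻ x, ((fun p : V × V => p.1 + p.2) ⁻¹' A).indicator (fun z => g z.1 * h z.2) (x, y) ∂m
      = ∫⁻ z, A.indicator (fun z => g (z - y) * h y) z ∂m := by
    intro y
    rw [← lintegral_add_right_eq_self (A.indicator (fun z => g (z - y) * h y)) y]
    congr 1
    ext x
    by_cases hx : x + y ∈ A
    · rw [indicator_of_mem (by exact hx), indicator_of_mem hx]; simp
    · rw [indicator_of_notMem (by exact hx), indicator_of_notMem hx]
  simp_rw [h1]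
  rw [lintegral_lintegral_swap]
  · congr 1
    ext z
    by_cases hz : z ∈ A
    · simp [indicator_of_mem hz]
    · simp [indicator_of_notMem hz]
  · have : (Function.uncurry fun y z => A.indicator (fun z => g (z - y) * h y) z) =
        (Prod.snd ⁻¹' A).indicator (fun p : V × V => g (p.2 - p.1) * h p.1) := by
      ext ⟨y, z⟩
      by_cases hz : z ∈ A
      · simp [Function.uncurry, hz]
      · simp [Function.uncurry, hz]
    rw [this]
    exact ((by fun_prop : Measurable fun p : V × V => g (p.2 - p.1) * h p.1).indicator
      (measurable_snd hA)).aemeasurable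

lemma conv_cont (m : Measure V) [m.IsAddHaarMeasure] (g h : V → ℝ≥0∞) (hg : Measurable g)
    (hh : Measurable h) (hg2 : ∫⁻ x, g x * g x ∂m < ∞) (hh2 : ∫⁻ x, h x * h x ∂m < ∞) :
    ∃ f : V → ℝ, Continuous f ∧
      ((m.withDensity g).prod (m.withDensity h)).map (fun p => p.1 + p.2) =
      m.withDensity (fun z => ENNReal.ofReal (f z)) := by
  rw [conv_density m g h hg hh]
  have hG := memLp_toReal m g hg hg2
  have hH := memLp_toReal m h hh hh2
  have hmp : ∀ z : V, MeasurePreserving (fun y => z - y) m m := fun z => Measure.measurePreserving_sub_left m z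
  have hmp' : ∀ z : V, MeasurePreserving (⟨fun y => z - y, by fun_prop⟩ : C(V, V)) m m := hmp
  have hc : Continuous (fun z : V => (⟨fun y => z - y, by fun_prop⟩ : C(V, V))) :=
    (ContinuousMap.mk (fun a : V × V ↦ a.1 - a.2) (by fun_prop)).curry.continuous
  have hF := Continuous.compMeasurePreservingLp (f := fun _ : V => hG.toLp _)
    continuous_const hc hmp' (by norm_num)
  refine ⟨fun z => inner ℝ (Lp.compMeasurePreserving _ (hmp' z) (hG.toLp _)) (hH.toLp _), ?_, ?_⟩
  · exact hF.inner continuous_const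
  · congr 1
    ext z
    simp only
    rw [L2.inner_def]
    have e1 : (fun y => inner ℝ ((Lp.compMeasurePreserving _ (hmp' z) (hG.toLp _) : Lp ℝ 2 m) y) ((hH.toLp _ : Lp ℝ 2 m) y)) =ᵐ[m]
        fun y => (g (z - y)).toReal * (h y).toReal := by
      filter_upwards [Lp.coeFn_compMeasurePreserving (hG.toLp _) (hmp' z), hH.coeFn_toLp,
        (hmp z).quasiMeasurePreserving.ae hG.coeFn_toLp] with y h1 h2 h3
      rw [h1, h2]
      simp only [Function.comp, ContinuousMap.coe_mk]
      rw [h3]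
      simp [mul_comm]
    rw [integral_congr_ae e1]
    have e2 : ∫ y, (g (z - y)).toReal * (h y).toReal ∂m = (∫⁻ y, g (z - y) * h y ∂m).toReal := by
      rw [← integral_toReal]
      · simp [ENNReal.toReal_mul]
      · fun_prop
      · filter_upwards [ae_ne_top_of_sq m h hh hh2,
          (hmp z).quasiMeasurePreserving.ae (ae_ne_top_of_sq m g hg hg2)] with y h1 h2
        exact ENNReal.mul_lt_top h2.lt_top h1.lt_top
    rw [e2, ENNReal.ofReal_toReal]
    -- finiteness
    have : ∫⁻ y, g (z - y) * h y ∂m ≤ ∫⁻ x, g x * g x ∂m + ∫⁻ x, h x * h x ∂m := by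
      rw [← (hmp z).lintegral_comp (f := fun x => g x * g x) (by fun_prop), ← lintegral_add_right _ (by fun_prop)]
      apply lintegral_mono
      intro y
      simp only
      rcases le_total (g (z - y)) (h y) with hle | hle
      · exact (mul_le_mul_left hle _).trans le_add_self
      · exact (mul_le_mul_right hle _).trans le_self_add
    exact (lt_of_le_of_lt this (ENNReal.add_lt_top.2 ⟨hg2, hh2⟩)).ne

lemma interior_of_density (m μ : Measure V) [m.IsAddHaarMeasure] (hμ : μ ≠ 0) (f : V → ℝ) (hf : Continuous f)
    (h : μ = m.withDensity (fun z => ENNReal.ofReal (f z))) (K : Set V) (hK : IsClosed K)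
    (hKμ : μ Kᶜ = 0) : (interior K).Nonempty := by
  have hU : IsOpen {z | 0 < f z} := isOpen_lt continuous_const hf
  have hne : {z | 0 < f z}.Nonempty := by
    by_contra hcon
    apply hμ
    rw [h]
    have : (fun z => ENNReal.ofReal (f z)) = 0 := by
      ext z
      simp only [Pi.zero_apply, ENNReal.ofReal_eq_zero]
      by_contra hz
      push Not at hz
      exact hcon ⟨z, hz⟩
    rw [this, withDensity_zero]
  have hsub : {z | 0 < f z} ⊆ K := by
    by_contra hcon
    obtain ⟨z, hz, hzK⟩ := not_subset.1 hcon
    have hW : IsOpen ({z | 0 < f z} ∩ Kᶜ) := hU.inter hK.isOpen_compl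
    have h0 : μ ({z | 0 < f z} ∩ Kᶜ) = 0 := measure_mono_null inter_subset_right hKμ
    rw [h, withDensity_apply _ hW.measurableSet, setLIntegral_eq_zero_iff hW.measurableSet
      (by fun_prop)] at h0
    have h1 : m ({z | 0 < f z} ∩ Kᶜ) = 0 := by
      rw [measure_eq_zero_iff_ae_notMem]
      filter_upwards [h0] with x hx hmem
      have := hx hmem
      simp only [ENNReal.ofReal_eq_zero] at this
      have h2 : 0 < f x := hmem.1
      linarith
    exact (hW.measure_pos m ⟨z, hz, hzK⟩).ne' h1
  exact hne.mono (interior_maximal hsub hU)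

end general


/-- uniform measure on two points -/
def nu2 : Measure (Fin 2) := (2 : ℝ≥0∞)⁻¹ • Measure.count

instance : IsProbabilityMeasure nu2 := ⟨by
  simp [nu2, Measure.count_univ]
  exact ENNReal.inv_mul_cancel (by norm_num) (by norm_num)⟩

/-- the Bernoulli measure -/
def bern : Measure (ℕ → Fin 2) := Measure.infinitePi (fun _ => nu2)

instance : IsProbabilityMeasure bern := by unfold bern; infer_instance

lemma bern_cyl (n : ℕ) (w : Fin n → Fin 2) :
    bern {ω | ∀ i : Fin n, ω i.1 = w i} = (2 : ℝ≥0∞)⁻¹ ^ n := by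
  have h := Measure.infinitePi_pi (fun _ : ℕ => nu2) (s := Finset.range n)
    (t := fun i => if h : i < n then {w ⟨i, h⟩} else univ) (fun i _ => by
      by_cases h : i < n <;> simp [h])
  have hs : {ω : ℕ → Fin 2 | ∀ i : Fin n, ω i.1 = w i} = (↑(Finset.range n) : Set ℕ).pi
      (fun i => if h : i < n then {w ⟨i, h⟩} else univ) := by
    ext ω
    simp only [mem_ofPred_eq, Set.mem_pi, Finset.coe_range, mem_Iio]
    constructor
    · intro h1 i hi
      simp [hi, h1 ⟨i, hi⟩]
    · intro h1 i
      have := h1 i.1 i.2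
      simpa using this
  rw [hs]
  unfold bern
  rw [h, Finset.prod_eq_pow_card (b := (2 : ℝ≥0∞)⁻¹)]
  · simp
  · intro i hi
    rw [dif_pos (Finset.mem_range.1 hi)]
    simp [nu2]

lemma bern_unique (ρ : Measure (ℕ → Fin 2)) (hρ : IsBernoulliWith (fun _ => (2 : ℝ≥0∞)⁻¹) ρ) :
    ρ = bern := by
  obtain ⟨hp, hc⟩ := hρ
  apply Measure.eq_infinitePi
  intro s t ht
  rw [← Measure.infinitePi_pi (fun _ : ℕ => nu2) (fun i _ => ht i)]
  change ρ _ = bern _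
  obtain ⟨n, hn⟩ : ∃ n, ∀ i ∈ s, i < n := ⟨s.sup id + 1, fun i hi => by
    have := Finset.le_sup (f := id) hi
    simp only [id] at this; omega⟩
  let res : (ℕ → Fin 2) → (Fin n → Fin 2) := fun ω i => ω i.1
  have hres : Measurable res := by fun_prop
  have hmap : ρ.map res = bern.map res := by
    apply Measure.ext_of_singleton
    intro w
    rw [Measure.map_apply hres (measurableSet_singleton _), Measure.map_apply hres (measurableSet_singleton _)]
    have : res ⁻¹' {w} = {ω | ∀ i : Fin n, ω i.1 = w i} := by
      ext ω
      simp [res, funext_iff]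
    rw [this, bern_cyl, hc]
    simp
  have hset : (↑s : Set ℕ).pi t = res ⁻¹' {w | ∀ i : Fin n, i.1 ∈ s → w i ∈ t i.1} := by
    ext ω
    simp only [Set.mem_pi, Finset.mem_coe, mem_preimage, mem_ofPred_eq, res]
    exact ⟨fun h i hi => h _ hi, fun h i hi => h ⟨i, hn i hi⟩ hi⟩
  rw [hset, ← Measure.map_apply hres (by measurability), hmap, Measure.map_apply hres (by measurability)]

lemma meas_extend (t : ℕ → ℕ) (ht : Function.Injective t) :
    Measurable (fun p : (ℕ → Fin 2) × (ℕ → Fin 2) => Function.extend t p.1 p.2) := by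
  rw [measurable_pi_iff]
  intro n
  by_cases h : ∃ m, t m = n
  · obtain ⟨m, rfl⟩ := h
    simp only [ht.extend_apply]
    fun_prop
  · simp only [Function.extend_apply' _ _ _ h]
    fun_prop

lemma join_mp (t : ℕ → ℕ) (ht : Function.Injective t) :
    MeasurePreserving (fun p : (ℕ → Fin 2) × (ℕ → Fin 2) => Function.extend t p.1 p.2)
      (bern.prod bern) bern := by
  classical
  refine ⟨meas_extend t ht, ?_⟩
  apply Measure.eq_infinitePi
  intro s T hT
  rw [Measure.map_apply (meas_extend t ht) (MeasurableSet.pi s.countable_toSet (fun i _ => hT i))]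
  set s1 := s.preimage t ht.injOn with hs1
  set s2 := s.filter (fun n => n ∉ Set.range t) with hs2
  have hpre : (fun p : (ℕ → Fin 2) × (ℕ → Fin 2) => Function.extend t p.1 p.2) ⁻¹' ((↑s : Set ℕ).pi T) =
      ((↑s1 : Set ℕ).pi (fun i => T (t i))) ×ˢ ((↑s2 : Set ℕ).pi T) := by
    ext p
    simp only [mem_preimage, Set.mem_pi, Finset.mem_coe, mem_prod, hs1, hs2, Finset.mem_preimage,
      Finset.mem_filter]
    constructor
    · intro h
      refine ⟨fun i hi => ?_, fun i hi => ?_⟩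
      · have := h _ hi
        rwa [ht.extend_apply] at this
      · have := h _ hi.1
        rwa [Function.extend_apply' _ _ _ hi.2] at this
    · rintro ⟨h1, h2⟩ i hi
      by_cases hr : i ∈ Set.range t
      · obtain ⟨m, rfl⟩ := hr
        rw [ht.extend_apply]
        exact h1 m hi
      · rw [Function.extend_apply' _ _ _ hr]
        exact h2 i ⟨hi, hr⟩
  rw [hpre, Measure.prod_prod]
  unfold bern
  rw [Measure.infinitePi_pi _ (fun i _ => hT _), Measure.infinitePi_pi _ (fun i _ => hT _)]
  rw [← Finset.prod_filter_mul_prod_filter_not s (fun n => n ∈ Set.range t)]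
  congr 1
  rw [hs1, Finset.prod_preimage' t s ht.injOn (fun i => nu2 (T i))]

/-- pairs of sequences -/
abbrev EE := (ℕ → Fin 2) × (ℕ → Fin 2)

/-- product measure -/
def PP : Measure EE := bern.prod bern

instance : IsProbabilityMeasure PP := by unfold PP; infer_instance

/-- join two pairs -/
def joinP (t : ℕ → ℕ) (z : EE × EE) : EE :=
  (Function.extend t z.1.1 z.2.1, Function.extend t z.1.2 z.2.2)

lemma joinP_mp (t : ℕ → ℕ) (ht : Function.Injective t) :
    MeasurePreserving (joinP t) (PP.prod PP) PP := by
  have h1 := (join_mp t ht).prod (join_mp t ht)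
  have hcomm : MeasurePreserving (fun z : EE × EE => ((z.1.1, z.2.1), (z.1.2, z.2.2)))
      (PP.prod PP) ((bern.prod bern).prod (bern.prod bern)) := by
    have e1 := measurePreserving_prodAssoc bern bern (bern.prod bern)
    have e2 := (measurePreserving_prodAssoc bern bern bern).symm
    have e3 : MeasurePreserving (Prod.swap : EE → EE) (bern.prod bern) (bern.prod bern) :=
      Measure.measurePreserving_swap
    have e4 := measurePreserving_prodAssoc bern bern bern
    have i1 := MeasurePreserving.id bern
    have i2 := i1.prod ((e4.comp (e3.prod i1)).comp e2)
    have e5 := (measurePreserving_prodAssoc bern bern (bern.prod bern)).symm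
    exact (e5.comp i2).comp e1
  exact h1.comp hcomm


/-- digit difference -/
def dd (p : EE) (j : ℕ) : ℝ := ((p.1 j).1 : ℝ) - ((p.2 j).1 : ℝ)

/-- power series with exponents `e` -/
def FF (e : ℕ → ℕ) (x : ℝ) (p : EE) : ℝ := ∑' j, dd p j * x ^ (e j)

/-- derivative series -/
def GG (e : ℕ → ℕ) (x : ℝ) (p : EE) : ℝ := ∑' j, dd p j * ((e j : ℝ) * x ^ (e j - 1))

lemma dd_abs (p : EE) (j : ℕ) : |dd p j| ≤ 1 := by
  unfold dd
  have h1 : ((p.1 j).1 : ℝ) ≤ 1 := by exact_mod_cast Nat.le_of_lt_succ (p.1 j).2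
  have h2 : ((p.2 j).1 : ℝ) ≤ 1 := by exact_mod_cast Nat.le_of_lt_succ (p.2 j).2
  have h3 : (0 : ℝ) ≤ ((p.1 j).1 : ℝ) := by positivity
  have h4 : (0 : ℝ) ≤ ((p.2 j).1 : ℝ) := by positivity
  rw [abs_le]; constructor <;> linarith

lemma dd_abs_eq (p : EE) (j : ℕ) (h : p.1 j ≠ p.2 j) : |dd p j| = 1 := by
  unfold dd
  generalize p.1 j = a at *
  generalize p.2 j = b at *
  fin_cases a <;> fin_cases b <;> simp_all

lemma dd_cont (j : ℕ) : Continuous (fun p : EE => dd p j) := by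
  unfold dd
  have h : Continuous (fun a : Fin 2 => (a.1 : ℝ)) := continuous_of_discreteTopology
  exact (h.comp ((continuous_apply j).comp continuous_fst)).sub
    (h.comp ((continuous_apply j).comp continuous_snd))

lemma sumF {e : ℕ → ℕ} (he : StrictMono e) {R : ℝ} (h0 : 0 ≤ R) (h1 : R < 1) :
    Summable (fun j => R ^ (e j)) :=
  (summable_geometric_of_lt_one h0 h1).comp_injective he.injective

lemma sumG {e : ℕ → ℕ} (he : StrictMono e) {R : ℝ} (h0 : 0 ≤ R) (h1 : R < 1) :
    Summable (fun j => (e j : ℝ) * R ^ (e j - 1)) := by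
  have h : Summable (fun n : ℕ => (n : ℝ) * R ^ (n - 1)) := by
    rw [← summable_nat_add_iff 1]
    have h2 : Summable (fun n : ℕ => (n : ℝ) ^ 1 * R ^ n) :=
      summable_pow_mul_geometric_of_norm_lt_one 1 (by rwa [Real.norm_of_nonneg h0])
    have h3 := h2.add (summable_geometric_of_lt_one h0 h1)
    refine h3.congr fun n => ?_
    push_cast
    simp; ring
  exact h.comp_injective he.injective

lemma bdF (e : ℕ → ℕ) {R x : ℝ} (hx : |x| ≤ R) (p : EE) (j : ℕ) :
    ‖dd p j * x ^ (e j)‖ ≤ R ^ (e j) := by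
  rw [norm_mul, norm_pow, Real.norm_eq_abs, Real.norm_eq_abs]
  calc _ ≤ 1 * R ^ e j := by
        gcongr
        exact dd_abs p j
    _ = _ := one_mul _

lemma bdG (e : ℕ → ℕ) {R x : ℝ} (hx : |x| ≤ R) (p : EE) (j : ℕ) :
    ‖dd p j * ((e j : ℝ) * x ^ (e j - 1))‖ ≤ (e j : ℝ) * R ^ (e j - 1) := by
  rw [norm_mul, norm_mul, norm_pow, Real.norm_eq_abs, Real.norm_eq_abs, Real.norm_eq_abs, Nat.abs_cast]
  calc _ ≤ 1 * ((e j : ℝ) * R ^ (e j - 1)) := by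
        gcongr
        exact dd_abs p j
    _ = _ := one_mul _

lemma FF_summable {e : ℕ → ℕ} (he : StrictMono e) {x : ℝ} (hx : |x| < 1) (p : EE) :
    Summable (fun j => dd p j * x ^ (e j)) :=
  Summable.of_norm_bounded (sumF he (abs_nonneg x) hx) (bdF e le_rfl p)

lemma GG_summable {e : ℕ → ℕ} (he : StrictMono e) {x : ℝ} (hx : |x| < 1) (p : EE) :
    Summable (fun j => dd p j * ((e j : ℝ) * x ^ (e j - 1))) :=
  Summable.of_norm_bounded (sumG he (abs_nonneg x) hx) (bdG e le_rfl p)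

lemma nh_aux {x : ℝ} (hx : |x| < 1) (p : EE) :
    ∃ R, |x| < R ∧ 0 ≤ R ∧ R < 1 ∧ {z : ℝ × EE | |z.1| ≤ R} ∈ 𝓝 (x, p) := by
  obtain ⟨R, h1, h2⟩ := exists_between hx
  refine ⟨R, h1, (abs_nonneg x).trans h1.le, h2, ?_⟩
  have : IsOpen {z : ℝ × EE | |z.1| < R} := isOpen_lt (by fun_prop) (by fun_prop)
  exact mem_of_superset (this.mem_nhds h1) (fun z (hz : |z.1| < R) => hz.le)

lemma FF_contAt {e : ℕ → ℕ} (he : StrictMono e) {x : ℝ} (hx : |x| < 1) (p : EE) :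
    ContinuousAt (fun z : ℝ × EE => FF e z.1 z.2) (x, p) := by
  obtain ⟨R, h1, h0, h2, h3⟩ := nh_aux hx p
  refine ContinuousOn.continuousAt ?_ h3
  exact continuousOn_tsum (fun j => (((dd_cont j).comp continuous_snd).mul
    (continuous_fst.pow _)).continuousOn) (sumF he h0 h2) (fun n z hz => bdF e hz _ n)

lemma GG_contAt {e : ℕ → ℕ} (he : StrictMono e) {x : ℝ} (hx : |x| < 1) (p : EE) :
    ContinuousAt (fun z : ℝ × EE => GG e z.1 z.2) (x, p) := by
  obtain ⟨R, h1, h0, h2, h3⟩ := nh_aux hx p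
  refine ContinuousOn.continuousAt ?_ h3
  exact continuousOn_tsum (fun j => (((dd_cont j).comp continuous_snd).mul
    (continuous_const.mul (continuous_fst.pow _))).continuousOn) (sumG he h0 h2) (fun n z hz => bdG e hz _ n)

lemma FF_deriv {e : ℕ → ℕ} (he : StrictMono e) {x : ℝ} (hx : |x| < 1) (p : EE) :
    HasDerivAt (fun x => FF e x p) (GG e x p) x := by
  obtain ⟨R, h1, h2⟩ := exists_between hx
  have h0 := (abs_nonneg x).trans h1.le
  have hm : ∀ y : ℝ, y ∈ Metric.ball (0 : ℝ) R ↔ |y| < R := fun y => by simp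
  have key := hasDerivAt_tsum_of_isPreconnected (g := fun j y => dd p j * y ^ (e j))
    (g' := fun j y => dd p j * ((e j : ℝ) * y ^ (e j - 1))) (t := Metric.ball (0 : ℝ) R) (y₀ := x) (y := x)
    (sumG he h0 h2) Metric.isOpen_ball (convex_ball _ _).isPreconnected ?_ ?_ ((hm x).2 h1)
    (FF_summable he hx p) ((hm x).2 h1)
  · exact key
  · intro n y _
    exact (hasDerivAt_pow (e n) y).const_mul (dd p n)
  · intro n y hy
    exact bdG e ((hm y).1 hy).le p n

/-- the good open set -/
lemma FF_open {e : ℕ → ℕ} (he : StrictMono e) (r : ℝ) :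
    IsOpen {z : ℝ × EE | |z.1| < 1 ∧ |FF e z.1 z.2| < r} := by
  have h1 : IsOpen {z : ℝ × EE | |z.1| < 1} := isOpen_lt (by fun_prop) (by fun_prop)
  have h2 : ContinuousOn (fun z : ℝ × EE => |FF e z.1 z.2|) {z : ℝ × EE | |z.1| < 1} :=
    fun z hz => (FF_contAt he hz z.2).continuousWithinAt.abs
  exact h2.isOpen_inter_preimage h1 isOpen_Iio

/-- transversality at a point -/
def AA (e : ℕ → ℕ) (x0 ε δ : ℝ) (p : EE) : Prop :=
  (∀ x ∈ Icc (x0 - ε) (x0 + ε), δ ≤ |FF e x p|) ∨ (∀ x ∈ Icc (x0 - ε) (x0 + ε), δ ≤ |GG e x p|)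

lemma AA_mono {e : ℕ → ℕ} {x0 ε δ ε' δ' : ℝ} (h1 : ε' ≤ ε) (h2 : δ' ≤ δ) {p : EE} (h : AA e x0 ε δ p) :
    AA e x0 ε' δ' p := by
  rcases h with h | h
  · left; intro x hx; exact h2.trans (h x ⟨by linarith [hx.1], by linarith [hx.2]⟩)
  · right; intro x hx; exact h2.trans (h x ⟨by linarith [hx.1], by linarith [hx.2]⟩)

lemma loc_aux (H : ℝ × EE → ℝ) (x : ℝ) (p : EE) (hH : ContinuousAt H (x, p)) (h0 : H (x, p) ≠ 0) :
    ∃ ε > 0, ∃ δ > 0, ∃ s ∈ 𝓝 p, ∀ q ∈ s, ∀ y ∈ Icc (x - ε) (x + ε), δ ≤ |H (y, q)| := by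
  have hpos := abs_pos.2 h0
  have h1 : ∀ᶠ z in 𝓝 (x, p), |H (x, p)| / 2 < |H z| :=
    hH.abs.eventually (lt_mem_nhds (by linarith))
  rw [nhds_prod_eq, eventually_prod_iff] at h1
  obtain ⟨P, hP, Q, hQ, h⟩ := h1
  obtain ⟨ε, hε, hb⟩ := Metric.nhds_basis_closedBall.mem_iff.1 hP
  refine ⟨ε, hε, |H (x, p)| / 2, by linarith, {q | Q q}, hQ, fun q hq y hy => (h (hb ?_) hq).le⟩
  rw [Real.closedBall_eq_Icc]; exact hy

lemma trans_loc {e : ℕ → ℕ} (he : StrictMono e) {x : ℝ} (hx : |x| < 1) (p : EE)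
    (h : FF e x p ≠ 0 ∨ GG e x p ≠ 0) :
    ∃ ε > 0, ∃ δ > 0, ∃ s ∈ 𝓝 p, ∀ q ∈ s, AA e x ε δ q := by
  rcases h with h | h
  · obtain ⟨ε, hε, δ, hδ, s, hs, hh⟩ := loc_aux _ x p (FF_contAt he hx p) h
    exact ⟨ε, hε, δ, hδ, s, hs, fun q hq => Or.inl (hh q hq)⟩
  · obtain ⟨ε, hε, δ, hδ, s, hs, hh⟩ := loc_aux _ x p (GG_contAt he hx p) h
    exact ⟨ε, hε, δ, hδ, s, hs, fun q hq => Or.inr (hh q hq)⟩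

lemma trans2 {e : ℕ → ℕ} (he : StrictMono e) {x y : ℝ} (hx : |x| < 1) (hy : |y| < 1)
    (h : ∀ p : EE, p.1 0 ≠ p.2 0 →
      (FF e x p ≠ 0 ∨ GG e x p ≠ 0) ∨ (FF e y p ≠ 0 ∨ GG e y p ≠ 0)) :
    ∃ ε > 0, ∃ δ > 0, ∀ p : EE, p.1 0 ≠ p.2 0 → AA e x ε δ p ∨ AA e y ε δ p := by
  have hcl : IsClosed {p : EE | p.1 0 ≠ p.2 0} := by
    have : Continuous (fun p : EE => (p.1 0, p.2 0)) := by fun_prop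
    exact (isClosed_discrete {z : Fin 2 × Fin 2 | z.1 ≠ z.2}).preimage this
  have := hcl.isCompact.induction_on
    (p := fun s => ∃ ε > 0, ∃ δ > 0, ∀ p ∈ s, AA e x ε δ p ∨ AA e y ε δ p) ?_ ?_ ?_ ?_
  · exact this
  · exact ⟨1, one_pos, 1, one_pos, by simp⟩
  · rintro s t hst ⟨ε, hε, δ, hδ, hh⟩
    exact ⟨ε, hε, δ, hδ, fun p hp => hh p (hst hp)⟩
  · rintro s t ⟨ε, hε, δ, hδ, hh⟩ ⟨ε', hε', δ', hδ', hh'⟩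
    refine ⟨min ε ε', lt_min hε hε', min δ δ', lt_min hδ hδ', ?_⟩
    rintro p (hp | hp)
    · exact (hh p hp).imp (AA_mono (min_le_left _ _) (min_le_left _ _)) (AA_mono (min_le_left _ _) (min_le_left _ _))
    · exact (hh' p hp).imp (AA_mono (min_le_right _ _) (min_le_right _ _)) (AA_mono (min_le_right _ _) (min_le_right _ _))
  · intro p hp
    rcases h p hp with h1 | h1
    · obtain ⟨ε, hε, δ, hδ, s, hs, hh⟩ := trans_loc he hx p h1
      exact ⟨s, mem_nhdsWithin_of_mem_nhds hs, ε, hε, δ, hδ, fun q hq => Or.inl (hh q hq)⟩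
    · obtain ⟨ε, hε, δ, hδ, s, hs, hh⟩ := trans_loc he hy p h1
      exact ⟨s, mem_nhdsWithin_of_mem_nhds hs, ε, hε, δ, hδ, fun q hq => Or.inr (hh q hq)⟩

lemma subl {e : ℕ → ℕ} (he : StrictMono e) {x0 ε δ : ℝ} (hδ : 0 < δ) (hε : 0 < ε) (hε1 : 2 * ε ≤ 1)
    (ha : 0 < x0 - ε) (hb : x0 + ε < 1) {p : EE} (hA : AA e x0 ε δ p) (N : ℕ) (r : ℝ) :
    volume {x | x ∈ Icc (x0 - ε) (x0 + ε) ∧ |x ^ N * FF e x p| < r} ≤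
      ENNReal.ofReal (2 * r / (δ * (x0 - ε) ^ N)) := by
  set a := x0 - ε with hadef
  have haN : 0 < a ^ N := pow_pos ha N
  have key : ∀ x ∈ Icc a (x0 + ε), |x ^ N * FF e x p| < r → a ^ N * |FF e x p| < r := by
    intro x hx h
    rw [abs_mul, abs_pow, abs_of_pos (ha.trans_le hx.1)] at h
    refine lt_of_le_of_lt ?_ h
    gcongr
    exact hx.1
  rcases hA with hA | hA
  · by_cases hne : ({x | x ∈ Icc a (x0 + ε) ∧ |x ^ N * FF e x p| < r}).Nonempty
    · obtain ⟨x, hx, hxr⟩ := hne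
      have h1 := key x hx hxr
      have h2 := hA x hx
      have h3 : a ^ N * δ < r := lt_of_le_of_lt (by gcongr) h1
      calc _ ≤ volume (Icc a (x0 + ε)) := measure_mono (fun y hy => hy.1)
        _ = ENNReal.ofReal (x0 + ε - a) := Real.volume_Icc
        _ ≤ _ := by
          apply ENNReal.ofReal_le_ofReal
          rw [le_div_iff₀ (by positivity)]
          nlinarith [mul_pos haN hδ]
    · rw [not_nonempty_iff_eq_empty.1 hne]; simp
  · refine (Real.volume_le_diam _).trans (Metric.ediam_le ?_)
    rintro x ⟨hx, hxr⟩ y ⟨hy, hyr⟩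
    rw [edist_dist]
    apply ENNReal.ofReal_le_ofReal
    have h1 := key x hx hxr
    have h2 := key y hy hyr
    rw [le_div_iff₀ (by positivity), Real.dist_eq]
    have mv : ∀ x y : ℝ, x ∈ Icc a (x0 + ε) → y ∈ Icc a (x0 + ε) → x < y →
        δ * |x - y| ≤ |FF e x p - FF e y p| := by
      intro x y hx hy hxy
      have hd : ∀ z ∈ Icc x y, HasDerivAt (fun x => FF e x p) (GG e z p) z := fun z hz =>
        FF_deriv he (by rw [abs_lt]; constructor <;> linarith [hz.1, hz.2, hx.1, hy.2]) p
      obtain ⟨c, hc, hc2⟩ := exists_hasDerivAt_eq_slope (fun x => FF e x p) (fun x => GG e x p) hxy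
        (fun z hz => (hd z hz).continuousAt.continuousWithinAt) (fun z hz => hd z (Ioo_subset_Icc_self hz))
      have h3 := hA c ⟨by linarith [hx.1, hc.1], by linarith [hy.2, hc.2]⟩
      have hyx : 0 < y - x := by linarith
      have h4 : FF e y p - FF e x p = GG e c p * (y - x) := by
        rw [hc2]; field_simp
      rw [abs_sub_comm x y, abs_sub_comm (FF e x p), h4, abs_mul]
      gcongr
    have h5 : δ * |x - y| ≤ |FF e x p - FF e y p| := by
      rcases lt_trichotomy x y with h | h | h
      · exact mv x y hx hy h
      · simp [h]
      · rw [abs_sub_comm x y, abs_sub_comm (FF e x p)]; exact mv y x hy hx h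
    have h6 := abs_sub (FF e x p) (FF e y p)
    have h7 : a ^ N * (δ * |x - y|) ≤ a ^ N * (|FF e x p| + |FF e y p|) := by
      gcongr; exact h5.trans h6
    nlinarith


/-- weighted digit sums -/
def SS (c : ℕ → ℝ) (ω : ℕ → Fin 2) : ℝ := ∑' j, ((ω j).1 : ℝ) * c j

lemma dig_le (a : Fin 2) : ((a.1 : ℕ) : ℝ) ≤ 1 := by exact_mod_cast Nat.le_of_lt_succ a.2

lemma SS_bd (c : ℕ → ℝ) (ω : ℕ → Fin 2) (j : ℕ) : ‖((ω j).1 : ℝ) * c j‖ ≤ |c j| := by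
  rw [norm_mul, Real.norm_eq_abs, Real.norm_eq_abs, Nat.abs_cast]
  calc _ ≤ 1 * |c j| := by gcongr; exact dig_le _
    _ = _ := one_mul _

lemma SS_summable {c : ℕ → ℝ} (hc : Summable (fun j => |c j|)) (ω : ℕ → Fin 2) :
    Summable (fun j => ((ω j).1 : ℝ) * c j) := Summable.of_norm_bounded hc (SS_bd c ω)

lemma SS_cont {c : ℕ → ℝ} (hc : Summable (fun j => |c j|)) : Continuous (SS c) := by
  refine continuous_tsum (fun j => ?_) hc (fun j ω => SS_bd c ω j)
  have h : Continuous (fun a : Fin 2 => (a.1 : ℝ)) := continuous_of_discreteTopology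
  exact (h.comp (continuous_apply j)).mul continuous_const

lemma FF_eq_SS {t : ℕ → ℕ} (ht : StrictMono t) {x : ℝ} (hx : |x| < 1) (p : EE) :
    FF t x p = SS (fun j => x ^ t j) p.1 - SS (fun j => x ^ t j) p.2 := by
  have hc : Summable (fun j => |x ^ t j|) := by
    simp only [abs_pow]; exact sumF ht (abs_nonneg x) hx
  unfold FF SS dd
  rw [← (SS_summable hc p.1).tsum_sub (SS_summable hc p.2)]
  congr 1; ext j; ring

lemma SS_join {c : ℕ → ℝ} (hc : Summable (fun j => |c j|)) {t : ℕ → ℕ} (ht : Function.Injective t)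
    (u v : ℕ → Fin 2) :
    SS c (Function.extend t u v) = SS (fun j => c (t j)) u + SS (indicator (range t)ᶜ c) v := by
  have h1 : ∀ j, ((Function.extend t u v j).1 : ℝ) * c j =
      Function.extend t (fun i => ((u i).1 : ℝ) * c (t i)) 0 j +
        ((v j).1 : ℝ) * indicator (range t)ᶜ c j := by
    intro j
    by_cases h : j ∈ range t
    · obtain ⟨i, rfl⟩ := h
      simp [ht.extend_apply]
    · rw [Function.extend_apply' _ _ _ h, Function.extend_apply' _ _ _ h]
      simp [h]
  have hc1 : Summable (fun j => |c (t j)|) := hc.comp_injective ht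
  have hc2 : Summable (fun j => |indicator (range t)ᶜ c j|) := by
    refine Summable.of_nonneg_of_le (fun j => abs_nonneg _) (fun j => ?_) hc
    by_cases h : j ∈ (range t)ᶜ
    · rw [indicator_of_mem h]
    · rw [indicator_of_notMem h]; simp
  unfold SS
  simp_rw [h1]
  rw [Summable.tsum_add _ (SS_summable hc2 v), tsum_extend_zero ht]
  rw [summable_extend_zero ht]
  exact SS_summable hc1 u

section
variable {V : Type*} [NormedAddCommGroup V] [NormedSpace ℝ V] [FiniteDimensional ℝ V]
  [MeasurableSpace V] [BorelSpace V] [SecondCountableTopology V]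

lemma enrg_map {X : (ℕ → Fin 2) → V} (hX : Measurable X) (r : ℝ) (y : V) :
    ((bern.map X).prod (bern.map X)) {p | ‖p.1 - p.2 - y‖ < r} = PP {p | ‖X p.1 - X p.2 - y‖ < r} := by
  rw [Measure.map_prod_map _ _ hX hX, Measure.map_apply (hX.prodMap hX)]
  · rfl
  · exact measurableSet_lt (by fun_prop) (by fun_prop)

lemma enrg_map0 {X : (ℕ → Fin 2) → V} (hX : Measurable X) (r : ℝ) :
    enrg (bern.map X) r = PP {p | ‖X p.1 - X p.2‖ < r} := by
  have := enrg_map hX r 0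
  simpa [enrg] using this

lemma join_energy [Nontrivial V] (m : Measure V) [m.IsAddHaarMeasure]
    {X T R : (ℕ → Fin 2) → V} (hX : Measurable X) (hT : Measurable T)
    {t : ℕ → ℕ} (ht : Function.Injective t)
    (hTX : ∀ u v, T (Function.extend t u v) = X u + R v) {r : ℝ} (hr : 0 < r) :
    PP {p | ‖T p.1 - T p.2‖ < r} ≤
      ENNReal.ofReal (2 ^ Module.finrank ℝ V) * PP {p | ‖X p.1 - X p.2‖ < 4 * r} := by
  have hS : MeasurableSet {p : EE | ‖T p.1 - T p.2‖ < r} :=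
    measurableSet_lt (by fun_prop) (by fun_prop)
  have hj := joinP_mp t ht
  rw [← hj.measure_preimage hS.nullMeasurableSet, Measure.prod_apply_symm (hj.measurable hS)]
  calc _ ≤ ∫⁻ z : EE, ENNReal.ofReal (2 ^ Module.finrank ℝ V) * PP {p | ‖X p.1 - X p.2‖ < 4 * r} ∂PP := by
        apply lintegral_mono
        intro z
        have hset : ((fun x : EE => (x, z)) ⁻¹' (joinP t ⁻¹' {p : EE | ‖T p.1 - T p.2‖ < r})) =
            {p | ‖X p.1 - X p.2 - (R z.2 - R z.1)‖ < r} := by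
          ext x
          simp only [mem_preimage, mem_ofPred_eq, joinP, hTX]
          rw [show X x.1 + R z.1 - (X x.2 + R z.2) = X x.1 - X x.2 - (R z.2 - R z.1) by abel]
        have : IsProbabilityMeasure (bern.map X) := Measure.isProbabilityMeasure_map hX.aemeasurable
        simp only
        rw [hset, ← enrg_map hX, ← enrg_map0 hX]
        exact en_shift m _ hr _
    _ = _ := by simp
end

/-- agreement on the first n entries -/
def Pre (n : ℕ) : Set EE := {p | ∀ i < n, p.1 i = p.2 i}

/-- shift -/
def shn (n : ℕ) (p : EE) : EE := (fun j => p.1 (n + j), fun j => p.2 (n + j))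

lemma Pre_meas (n : ℕ) : MeasurableSet (Pre n) := by
  have : Pre n = ⋂ i ∈ Finset.range n, {p : EE | p.1 i = p.2 i} := by
    ext p; simp [Pre]
  rw [this]
  exact Finset.measurableSet_biInter _ (fun i _ => measurableSet_eq_fun (by fun_prop) (by fun_prop))

lemma PP_Pre (n : ℕ) : PP (Pre n) = (2 : ℝ≥0∞)⁻¹ ^ n := by
  unfold PP
  rw [Measure.prod_apply (Pre_meas n)]
  have : ∀ x : ℕ → Fin 2, bern (Prod.mk x ⁻¹' Pre n) = (2 : ℝ≥0∞)⁻¹ ^ n := by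
    intro x
    rw [← bern_cyl n (fun i => x i.1)]
    congr 1
    ext ω
    simp only [Pre, mem_preimage, mem_ofPred_eq]
    exact ⟨fun h i => (h i.1 i.2).symm, fun h i hi => (h ⟨i, hi⟩).symm⟩
  simp [this]

lemma shn_joinP (n : ℕ) (z : EE × EE) : shn n (joinP (fun m => n + m) z) = z.1 := by
  have h : Function.Injective (fun m : ℕ => n + m) := fun a b hab => by simpa using hab
  unfold shn joinP
  have h1 : ∀ (u v : ℕ → Fin 2) j, Function.extend (fun m => n + m) u v (n + j) = u j :=
    fun u v j => h.extend_apply u v j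
  simp [h1]

lemma PP_Pre_shn (n : ℕ) {B : Set EE} (hB : MeasurableSet B) :
    PP {p | p ∈ Pre n ∧ shn n p ∈ B} = (2 : ℝ≥0∞)⁻¹ ^ n * PP B := by
  have h : Function.Injective (fun m : ℕ => n + m) := fun a b hab => by simpa using hab
  have hm : Measurable (shn n) := by unfold shn; fun_prop
  have hS : MeasurableSet {p | p ∈ Pre n ∧ shn n p ∈ B} := (Pre_meas n).inter (hm hB)
  have hj := joinP_mp _ h
  rw [← hj.measure_preimage hS.nullMeasurableSet]
  have : joinP (fun m => n + m) ⁻¹' {p | p ∈ Pre n ∧ shn n p ∈ B} = B ×ˢ Pre n := by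
    ext z
    simp only [mem_preimage, mem_ofPred_eq, shn_joinP, mem_prod, Pre]
    rw [and_comm]
    refine and_congr_right fun _ => forall₂_congr fun i hi => ?_
    have : ¬ ∃ m, n + m = i := by rintro ⟨m, rfl⟩; omega
    simp only [joinP]
    rw [Function.extend_apply' _ _ _ this, Function.extend_apply' _ _ _ this]
  rw [this, Measure.prod_prod, PP_Pre, mul_comm]

lemma ae_cover : ∀ᵐ p ∂PP, ∃ n, p ∈ Pre n ∧ (shn n p).1 0 ≠ (shn n p).2 0 := by
  rw [ae_iff]
  have hsub : ∀ n, {p : EE | ¬ ∃ n, p ∈ Pre n ∧ (shn n p).1 0 ≠ (shn n p).2 0} ⊆ Pre n := by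
    intro n p hp
    have hp : ¬ ∃ n, p ∈ Pre n ∧ (shn n p).1 0 ≠ (shn n p).2 0 := hp
    push Not at hp
    induction n with
    | zero => intro i hi; omega
    | succ n ih =>
      have := hp n ih
      intro i hi
      rcases Nat.lt_succ_iff_lt_or_eq.1 hi with h | h
      · exact ih i h
      · subst h; simpa [shn] using this
  have h1 : ∀ n, PP {p : EE | ¬ ∃ n, p ∈ Pre n ∧ (shn n p).1 0 ≠ (shn n p).2 0} ≤ (2 : ℝ≥0∞)⁻¹ ^ n :=
    fun n => (measure_mono (hsub n)).trans (PP_Pre n).le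
  have h2 : Tendsto (fun n : ℕ => (2 : ℝ≥0∞)⁻¹ ^ n) atTop (𝓝 0) :=
    ENNReal.tendsto_pow_atTop_nhds_zero_of_lt_one (by simp)
  exact le_antisymm (ge_of_tendsto' h2 h1) (zero_le)

lemma FF_shift {t : ℕ → ℕ} (ht : StrictMono t) {x : ℝ} (hx : |x| < 1) (n : ℕ) {p : EE} (hp : p ∈ Pre n) :
    FF t x p = x ^ (t n) * FF (fun j => t (n + j) - t n) x (shn n p) := by
  unfold FF
  rw [← (FF_summable ht hx p).sum_add_tsum_nat_add n, Finset.sum_eq_zero, zero_add, ← tsum_mul_left]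
  · congr 1; ext j
    have h1 : dd p (j + n) = dd (shn n p) j := by simp [dd, shn, add_comm]
    rw [h1, show t (j + n) = t n + (t (n + j) - t n) by
      rw [add_comm j n]; have := ht.monotone (Nat.le_add_right n j); omega, pow_add]
    ring
  · intro i hi
    have := hp i (Finset.mem_range.1 hi)
    simp [dd, this]

lemma sh_mono {t : ℕ → ℕ} (ht : StrictMono t) (n : ℕ) : StrictMono (fun j => t (n + j) - t n) := by
  intro a b hab
  have h1 := ht (show n + a < n + b by omega)
  have h2 := ht.monotone (Nat.le_add_right n a)
  have h3 := ht.monotone (Nat.le_add_right n b)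
  show t (n + a) - t n < t (n + b) - t n
  omega


lemma Smeas {t : ℕ → ℕ} (ht : StrictMono t) {a b : ℝ} (ha : 0 < a) (hb : b < 1) (r : ℝ) :
    MeasurableSet {z : ℝ × EE | z.1 ∈ Icc a b ∧ |FF t z.1 z.2| < r} := by
  have : {z : ℝ × EE | z.1 ∈ Icc a b ∧ |FF t z.1 z.2| < r} =
      {z : ℝ × EE | z.1 ∈ Icc a b} ∩ {z : ℝ × EE | |z.1| < 1 ∧ |FF t z.1 z.2| < r} := by
    ext z
    simp only [mem_ofPred_eq, mem_inter_iff]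
    constructor
    · rintro ⟨h1, h2⟩
      exact ⟨h1, by rw [abs_lt]; constructor <;> linarith [h1.1, h1.2], h2⟩
    · rintro ⟨h1, h2⟩
      exact ⟨h1, h2.2⟩
  rw [this]
  exact (measurable_fst measurableSet_Icc).inter (FF_open ht r).measurableSet

lemma tonelli1 {t : ℕ → ℕ} (ht : StrictMono t) {a b : ℝ} (ha : 0 < a) (hb : b < 1) (r : ℝ) :
    ∫⁻ x in Icc a b, PP {p | |FF t x p| < r} =
      ∫⁻ p, volume {x | x ∈ Icc a b ∧ |FF t x p| < r} ∂PP := by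
  have hS := Smeas ht ha hb r
  have h1 := Measure.prod_apply (μ := (volume : Measure ℝ)) (ν := PP) hS
  have h2 := Measure.prod_apply_symm (μ := (volume : Measure ℝ)) (ν := PP) hS
  rw [h1] at h2
  rw [← lintegral_indicator measurableSet_Icc]
  refine Eq.trans ?_ (h2.trans rfl)
  apply lintegral_congr
  intro x
  by_cases hx : x ∈ Icc a b
  · rw [indicator_of_mem hx]
    congr 1
    ext p
    simp only [mem_preimage, mem_ofPred_eq]
    tauto
  · rw [indicator_of_notMem hx]
    have : (Prod.mk x ⁻¹' {z : ℝ × EE | z.1 ∈ Icc a b ∧ |FF t z.1 z.2| < r}) = ∅ := by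
      ext p
      simp only [mem_preimage, mem_ofPred_eq, mem_empty_iff_false, iff_false]
      tauto
    rw [this]; simp

lemma T1_t {t : ℕ → ℕ} (ht : StrictMono t) {x0 ε δ : ℝ} (hδ : 0 < δ) (hε : 0 < ε) (hε1 : 2 * ε ≤ 1)
    (ha : 0 < x0 - ε) (hb : x0 + ε < 1)
    (hA : ∀ n, ∀ p : EE, p.1 0 ≠ p.2 0 → AA (fun j => t (n + j) - t n) x0 ε δ p)
    (hs : Summable (fun n => (2 ^ n * (x0 - ε) ^ (t n))⁻¹)) :
    ∃ C : ℝ, ∀ r > 0, ∫⁻ x in Icc (x0 - ε) (x0 + ε), PP {p | |FF t x p| < r} ≤ ENNReal.ofReal (C * r) := by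
  set a := x0 - ε with hadef
  refine ⟨2 / δ * ∑' n, (2 ^ n * a ^ (t n))⁻¹, fun r hr => ?_⟩
  rw [tonelli1 ht ha hb]
  calc _ ≤ ∫⁻ p, ∑' n, (Pre n).indicator (fun _ => ENNReal.ofReal (2 * r / (δ * a ^ (t n)))) p ∂PP := by
        apply lintegral_mono_ae
        filter_upwards [ae_cover] with p hp
        obtain ⟨n, hn, hn0⟩ := hp
        refine le_trans ?_ (ENNReal.le_tsum n)
        rw [indicator_of_mem hn]
        refine le_trans (measure_mono ?_) (subl (sh_mono ht n) hδ hε hε1 ha hb (hA n _ hn0) (t n) r)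
        rintro x ⟨hx, hxr⟩
        refine ⟨hx, ?_⟩
        rwa [← FF_shift ht (by rw [abs_lt]; constructor <;> linarith [hx.1, hx.2]) n hn]
    _ = ∑' n, ENNReal.ofReal (2 * r / δ * (2 ^ n * a ^ (t n))⁻¹) := by
        rw [lintegral_tsum (fun n => (measurable_const.indicator (Pre_meas n)).aemeasurable)]
        congr 1; ext n
        rw [lintegral_indicator_const (Pre_meas n), PP_Pre,
          show (2 : ℝ≥0∞)⁻¹ ^ n = ENNReal.ofReal ((2 : ℝ)⁻¹ ^ n) by
            rw [ENNReal.ofReal_pow (by norm_num), ENNReal.ofReal_inv_of_pos (by norm_num)]; simp,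
          ← ENNReal.ofReal_mul (by positivity)]
        congr 1
        field_simp
        rw [← mul_pow]; norm_num
    _ = _ := by
        rw [← ENNReal.ofReal_tsum_of_nonneg (fun n => by positivity) (hs.mul_left _), tsum_mul_left]
        congr 1; ring

/-- one dimensional energy estimate on a set -/
def T1 (J : Set ℝ) : Prop :=
  ∃ C : ℝ, ∀ r > 0, ∫⁻ x in J, PP {p | |FF (fun j => j) x p| < r} ≤ ENNReal.ofReal (C * r)

lemma T1.mono {J J' : Set ℝ} (h : T1 J) (hJ : J' ⊆ J) : T1 J' := by
  obtain ⟨C, hC⟩ := h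
  exact ⟨C, fun r hr => (lintegral_mono_set hJ).trans (hC r hr)⟩

lemma id_mono : StrictMono (fun j : ℕ => j) := strictMono_id

lemma FF_transfer {t : ℕ → ℕ} (ht : StrictMono t) {x : ℝ} (hx : |x| < 1) {r : ℝ} (hr : 0 < r) :
    PP {p | |FF (fun j => j) x p| < r} ≤ 2 * PP {p | |FF t x p| < 4 * r} := by
  have hc : Summable (fun j : ℕ => |x ^ j|) := by
    simp only [abs_pow]; exact sumF id_mono (abs_nonneg x) hx
  have hct : Summable (fun j : ℕ => |x ^ t j|) := by
    simp only [abs_pow]; exact sumF ht (abs_nonneg x) hx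
  have := join_energy (V := ℝ) volume (SS_cont hct).measurable (SS_cont hc).measurable ht.injective
    (fun u v => SS_join hc ht.injective u v) hr
  simp only [Real.norm_eq_abs, ← FF_eq_SS ht hx] at this
  have h2 : ∀ p, SS (fun j : ℕ => x ^ j) p.1 - SS (fun j : ℕ => x ^ j) p.2 = FF (fun j => j) x p :=
    fun p => (FF_eq_SS id_mono hx p).symm
  simp only [h2] at this
  simpa using this

lemma T1_id {t : ℕ → ℕ} (ht : StrictMono t) {x0 ε δ : ℝ} (hδ : 0 < δ) (hε : 0 < ε) (hε1 : 2 * ε ≤ 1)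
    (ha : 0 < x0 - ε) (hb : x0 + ε < 1)
    (hA : ∀ n, ∀ p : EE, p.1 0 ≠ p.2 0 → AA (fun j => t (n + j) - t n) x0 ε δ p)
    (hs : Summable (fun n => (2 ^ n * (x0 - ε) ^ (t n))⁻¹)) :
    T1 (Icc (x0 - ε) (x0 + ε)) := by
  obtain ⟨C, hC⟩ := T1_t ht hδ hε hε1 ha hb hA hs
  refine ⟨2 * (C * 4), fun r hr => ?_⟩
  calc _ ≤ ∫⁻ x in Icc (x0 - ε) (x0 + ε), 2 * PP {p | |FF t x p| < 4 * r} := by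
        apply setLIntegral_mono' measurableSet_Icc
        intro x hx
        exact FF_transfer ht (by rw [abs_lt]; constructor <;> linarith [hx.1, hx.2]) hr
    _ = 2 * ∫⁻ x in Icc (x0 - ε) (x0 + ε), PP {p | |FF t x p| < 4 * r} := by
        rw [lintegral_const_mul' _ _ (by norm_num)]
    _ ≤ 2 * ENNReal.ofReal (C * (4 * r)) := by gcongr; exact hC _ (by linarith)
    _ = _ := by
        rw [show (2 : ℝ≥0∞) = ENNReal.ofReal 2 by simp, ← ENNReal.ofReal_mul (by norm_num)]
        congr 1; ring


/-- Euler operator applied to the series -/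
def HH (e : ℕ → ℕ) (x : ℝ) (p : EE) : ℝ := ∑' j, dd p j * ((e j : ℝ) * x ^ (e j))

lemma HH_term (n : ℕ) (x : ℝ) : (n : ℝ) * x ^ n = x * ((n : ℝ) * x ^ (n - 1)) := by
  rcases n with _ | n
  · simp
  · simp [pow_succ]; ring

lemma HH_eq (e : ℕ → ℕ) (x : ℝ) (p : EE) : HH e x p = x * GG e x p := by
  unfold HH GG
  rw [← tsum_mul_left]
  congr 1; ext j
  rw [HH_term]; ring

lemma HH_summable {e : ℕ → ℕ} (he : StrictMono e) {x : ℝ} (hx : |x| < 1) (p : EE) :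
    Summable (fun j => dd p j * ((e j : ℝ) * x ^ (e j))) := by
  refine ((GG_summable he hx p).mul_left x).congr fun j => ?_
  rw [HH_term]; ring

lemma sumK {e : ℕ → ℕ} (he : StrictMono e) {x : ℝ} (h0 : 0 ≤ x) (h1 : x < 1) (κ : ℝ) :
    Summable (fun j => |(e j : ℝ) - κ| * x ^ e j) := by
  have hb : Summable (fun j => x * ((e j : ℝ) * x ^ (e j - 1)) + |κ| * x ^ e j) :=
    ((sumG he h0 h1).mul_left x).add ((sumF he h0 h1).mul_left |κ|)
  refine Summable.of_nonneg_of_le (fun j => by positivity) (fun j => ?_) hb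
  rw [← HH_term, ← add_mul]
  gcongr
  have := abs_sub (e j : ℝ) κ
  rwa [Nat.abs_cast] at this

lemma nodz {e : ℕ → ℕ} (he : StrictMono e) (he0 : e 0 = 0) {x : ℝ} (h0 : 0 < x) (h1 : x < 1) {κ : ℝ}
    (hκ : 0 < κ) (hs : ∑' j, |(e (j + 1) : ℝ) - κ| * x ^ e (j + 1) < κ) (p : EE) (hp : p.1 0 ≠ p.2 0) :
    FF e x p ≠ 0 ∨ HH e x p ≠ 0 := by
  by_contra hcon
  push Not at hcon
  obtain ⟨hF, hH⟩ := hcon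
  have hx : |x| < 1 := by rwa [abs_of_pos h0]
  have hsum : Summable (fun j => dd p j * (((e j : ℝ) - κ) * x ^ e j)) := by
    refine ((HH_summable he hx p).sub ((FF_summable he hx p).mul_left κ)).congr fun j => by ring
  have h2 : ∑' j, dd p j * (((e j : ℝ) - κ) * x ^ e j) = 0 := by
    have : HH e x p - κ * FF e x p = 0 := by rw [hF, hH]; simp
    rw [← this]
    unfold HH FF
    rw [← tsum_mul_left, ← (HH_summable he hx p).tsum_sub ((FF_summable he hx p).mul_left κ)]
    congr 1; ext j; ring
  rw [hsum.tsum_eq_zero_add, he0] at h2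
  have hk := sumK he h0.le h1 κ
  have hk' := (summable_nat_add_iff 1).2 hk
  have h3 : |∑' j, dd p (j + 1) * (((e (j + 1) : ℝ) - κ) * x ^ e (j + 1))| ≤
      ∑' j, |(e (j + 1) : ℝ) - κ| * x ^ e (j + 1) := by
    rw [← Real.norm_eq_abs]
    refine tsum_of_norm_bounded hk'.hasSum fun j => ?_
    rw [norm_mul, norm_mul, Real.norm_eq_abs, Real.norm_eq_abs, Real.norm_eq_abs, abs_pow, abs_of_pos h0]
    calc _ ≤ 1 * (|(e (j + 1) : ℝ) - κ| * x ^ e (j + 1)) := by gcongr; exact dd_abs _ _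
      _ = _ := one_mul _
  have h4 : ∑' j, dd p (j + 1) * (((e (j + 1) : ℝ) - κ) * x ^ e (j + 1)) = dd p 0 * κ := by
    simp at h2; linarith
  rw [h4, abs_mul, dd_abs_eq p 0 hp, abs_of_pos hκ] at h3
  linarith

lemma full_sum {x : ℝ} (h0 : 0 ≤ x) (h1 : x < 1) (κ : ℕ) :
    ∑' i : ℕ, |(i : ℝ) - κ| * x ^ i =
      (∑ i ∈ Finset.range κ, ((κ : ℝ) - i) * x ^ i) + x ^ κ * (x / (1 - x) ^ 2) := by
  have hk := sumK id_mono h0 h1 κ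
  rw [← hk.sum_add_tsum_nat_add κ]
  congr 1
  · apply Finset.sum_congr rfl
    intro i hi
    have : (i : ℝ) ≤ κ := by exact_mod_cast (Finset.mem_range.1 hi).le
    rw [abs_of_nonpos (by linarith)]; ring
  · rw [← tsum_coe_mul_geometric_of_norm_lt_one (by rwa [Real.norm_of_nonneg h0]), ← tsum_mul_left]
    congr 1; ext i
    push_cast
    rw [show (i : ℝ) + κ - κ = i by ring, Nat.abs_cast, pow_add]; ring

lemma nodz_num {e : ℕ → ℕ} (he : StrictMono e) (he0 : e 0 = 0) (κ : ℕ) (exc : Finset ℕ)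
    (hexc : ∀ j, e (j + 1) ∉ exc) {x1 : ℝ} (h1 : x1 < 1)
    (hnum : (∑ i ∈ Finset.range κ, ((κ : ℝ) - i) * x1 ^ i) + x1 ^ κ * (x1 / (1 - x1) ^ 2) -
      ∑ i ∈ exc, |(i : ℝ) - κ| * x1 ^ i < κ) (hκ : 0 < κ)
    {x : ℝ} (h0 : 0 < x) (hx : x ≤ x1) (p : EE) (hp : p.1 0 ≠ p.2 0) :
    FF e x p ≠ 0 ∨ HH e x p ≠ 0 := by
  have h01 : 0 < x1 := h0.trans_le hx
  refine nodz he he0 h0 (hx.trans_lt h1) (κ := κ) (by exact_mod_cast hκ) ?_ p hp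
  refine lt_of_le_of_lt ?_ hnum
  have hk := sumK he h01.le h1 κ
  have hk' := (summable_nat_add_iff 1).2 hk
  have hk2 := (summable_nat_add_iff 1).2 (sumK he h0.le (hx.trans_lt h1) κ)
  have hfull := sumK id_mono h01.le h1 κ
  have hf : Summable (fun i : ℕ => if i ∈ exc then 0 else |(i : ℝ) - κ| * x1 ^ i) :=
    Summable.of_nonneg_of_le (fun i => by split_ifs <;> positivity)
      (fun i => by split_ifs <;> first | positivity | exact le_rfl) hfull
  have hg : Summable (fun i : ℕ => if i ∈ exc then |(i : ℝ) - κ| * x1 ^ i else 0) :=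
    Summable.of_nonneg_of_le (fun i => by split_ifs <;> positivity)
      (fun i => by split_ifs <;> first | positivity | exact le_rfl) hfull
  have hinj : Function.Injective (fun j => e (j + 1)) := fun a b hab => by
    have := he.injective hab; omega
  calc ∑' j, |(e (j + 1) : ℝ) - κ| * x ^ e (j + 1)
      ≤ ∑' j, |(e (j + 1) : ℝ) - κ| * x1 ^ e (j + 1) := by
        apply hk2.tsum_le_tsum _ hk'
        intro j; gcongr
    _ = ∑' j, (fun i : ℕ => if i ∈ exc then 0 else |(i : ℝ) - κ| * x1 ^ i) (e (j + 1)) := by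
        congr 1; ext j
        simp [hexc j]
    _ ≤ ∑' i : ℕ, if i ∈ exc then 0 else |(i : ℝ) - κ| * x1 ^ i :=
        tsum_comp_le_tsum_of_inj hf (fun i => by split_ifs <;> positivity) hinj
    _ = _ := by
        have h5 : ∑ i ∈ exc, |(i : ℝ) - κ| * x1 ^ i = ∑' i : ℕ, if i ∈ exc then |(i : ℝ) - κ| * x1 ^ i else 0 := by
          rw [tsum_eq_sum (s := exc) (fun b hb => by simp [hb])]
          exact Finset.sum_congr rfl (fun i hi => by simp [hi])
        rw [← full_sum h01.le h1, h5, ← hfull.tsum_sub hg]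
        congr 1; ext i
        split_ifs <;> simp

lemma toG {e : ℕ → ℕ} {x : ℝ} {p : EE} (h : FF e x p ≠ 0 ∨ HH e x p ≠ 0) :
    FF e x p ≠ 0 ∨ GG e x p ≠ 0 := by
  refine h.imp id fun h => ?_
  rw [HH_eq] at h
  exact right_ne_zero_of_mul h

lemma nodz_id {x : ℝ} (h0 : 0 < x) (hx : x ≤ 0.649) (p : EE) (hp : p.1 0 ≠ p.2 0) :
    FF (fun j => j) x p ≠ 0 ∨ HH (fun j => j) x p ≠ 0 := by
  refine nodz_num id_mono rfl 4 {0} (by simp) (x1 := 0.649) (by norm_num) ?_ (by norm_num) h0 hx p hp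
  simp [Finset.sum_range_succ]
  norm_num

lemma nodz_k (k : ℕ) (hk : 0 < k) {x : ℝ} (h0 : 0 < x) (hx : x ^ k ≤ 0.649) (p : EE) (hp : p.1 0 ≠ p.2 0) :
    FF (fun j => k * j) x p ≠ 0 ∨ GG (fun j => k * j) x p ≠ 0 := by
  have h := nodz_id (pow_pos h0 k) hx p hp
  apply toG
  have h1 : FF (fun j => k * j) x p = FF (fun j => j) (x ^ k) p := by
    unfold FF; congr 1; ext j; rw [pow_mul]
  have h2 : HH (fun j => k * j) x p = k * HH (fun j => j) (x ^ k) p := by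
    unfold HH; rw [← tsum_mul_left]; congr 1; ext j; rw [pow_mul]; push_cast; ring
  rw [h1, h2]
  refine h.imp id fun h => mul_ne_zero (by exact_mod_cast hk.ne') h

lemma evm : StrictMono (fun j : ℕ => j + j / 2) := by
  intro a b hab; show a + a / 2 < b + b / 2; omega
lemma odm : StrictMono (fun j : ℕ => j + (j + 1) / 2) := by
  intro a b hab; show a + (a + 1) / 2 < b + (b + 1) / 2; omega

lemma nodz_ev {x : ℝ} (h0 : 0 < x) (hx : x ≤ 0.7072) (p : EE) (hp : p.1 0 ≠ p.2 0) :
    FF (fun j => j + j / 2) x p ≠ 0 ∨ GG (fun j => j + j / 2) x p ≠ 0 := by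
  refine toG (nodz_num evm rfl 4 {0, 2, 5, 8, 11} ?_ (x1 := 0.7072) (by norm_num) ?_ (by norm_num) h0 hx p hp)
  · intro j
    simp only [Finset.mem_insert, Finset.mem_singleton]
    omega
  · simp [Finset.sum_range_succ]
    norm_num [abs_of_pos, abs_of_neg]

lemma nodz_od {x : ℝ} (h0 : 0 < x) (hx : x ≤ 0.7072) (p : EE) (hp : p.1 0 ≠ p.2 0) :
    FF (fun j => j + (j + 1) / 2) x p ≠ 0 ∨ GG (fun j => j + (j + 1) / 2) x p ≠ 0 := by
  refine toG (nodz_num odm rfl 5 {0, 1, 4} ?_ (x1 := 0.7072) (by norm_num) ?_ (by norm_num) h0 hx p hp)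
  · intro j
    simp only [Finset.mem_insert, Finset.mem_singleton]
    omega
  · simp [Finset.sum_range_succ]
    norm_num [abs_of_pos, abs_of_neg]

lemma T1_loc {t e e' : ℕ → ℕ} (ht : StrictMono t) (he : StrictMono e) (he' : StrictMono e')
    (hpat : ∀ n, (fun j => t (n + j) - t n) = e ∨ (fun j => t (n + j) - t n) = e')
    {x0 a0 : ℝ} (ha0 : 0 < a0) (hax : a0 < x0) (hx1 : x0 < 1)
    (hs : Summable (fun n => (2 ^ n * a0 ^ (t n))⁻¹))
    (h : ∀ p : EE, p.1 0 ≠ p.2 0 → FF e x0 p ≠ 0 ∨ GG e x0 p ≠ 0)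
    (h' : ∀ p : EE, p.1 0 ≠ p.2 0 → FF e' x0 p ≠ 0 ∨ GG e' x0 p ≠ 0) :
    ∃ ε > 0, T1 (Icc (x0 - ε) (x0 + ε)) := by
  have hx : |x0| < 1 := by rw [abs_of_pos (ha0.trans hax)]; exact hx1
  obtain ⟨ε1, hε1, δ1, hδ1, hh1⟩ := trans2 he hx hx (fun p hp => Or.inl (h p hp))
  obtain ⟨ε2, hε2, δ2, hδ2, hh2⟩ := trans2 he' hx hx (fun p hp => Or.inl (h' p hp))
  set ε := min (min ε1 ε2) (min (x0 - a0) ((1 - x0) / 2)) with hεd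
  have hε : 0 < ε := lt_min (lt_min hε1 hε2) (lt_min (by linarith) (by linarith))
  have e1 : ε ≤ ε1 := (min_le_left _ _).trans (min_le_left _ _)
  have e2 : ε ≤ ε2 := (min_le_left _ _).trans (min_le_right _ _)
  have e3 : ε ≤ x0 - a0 := (min_le_right _ _).trans (min_le_left _ _)
  have e4 : ε ≤ (1 - x0) / 2 := (min_le_right _ _).trans (min_le_right _ _)
  refine ⟨ε, hε, T1_id ht (δ := min δ1 δ2) (lt_min hδ1 hδ2) hε (by linarith) (by linarith) (by linarith) ?_ ?_⟩
  · intro n p hp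
    rcases hpat n with hn | hn
    · rw [hn]
      exact AA_mono e1 (min_le_left _ _) ((hh1 p hp).elim id id)
    · rw [hn]
      exact AA_mono e2 (min_le_right _ _) ((hh2 p hp).elim id id)
  · refine Summable.of_nonneg_of_le (fun n => ?_) (fun n => ?_) hs
    · have : 0 < x0 - ε := by linarith
      positivity
    · have : a0 ≤ x0 - ε := by linarith
      gcongr

lemma T1_T3 {x0 : ℝ} (h0 : 0.649 ≤ x0) (h1 : x0 ≤ 0.7072) : ∃ ε > 0, T1 (Icc (x0 - ε) (x0 + ε)) := by
  refine T1_loc (t := fun j => j + j / 2) (e := fun j => j + j / 2) (e' := fun j => j + (j + 1) / 2)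
    evm evm odm ?_ (a0 := 0.64) (by norm_num) (by linarith) (by linarith) ?_
    (nodz_ev (by linarith) h1) (nodz_od (by linarith) h1)
  · intro n
    rcases Nat.even_or_odd' n with ⟨i, hi | hi⟩
    · left; ext j; show n + j + (n + j) / 2 - (n + n / 2) = j + j / 2; omega
    · right; ext j; show n + j + (n + j) / 2 - (n + n / 2) = j + (j + 1) / 2; omega
  · have hb : Summable (fun n : ℕ => ((1.02 : ℝ)⁻¹) ^ n) :=
      summable_geometric_of_lt_one (by norm_num) (by norm_num)
    refine Summable.of_nonneg_of_le (fun n => by positivity) (fun n => ?_) hb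
    rw [inv_pow]
    gcongr
    rw [← pow_le_pow_iff_left₀ (by positivity) (by positivity) (two_ne_zero), mul_pow, ← pow_mul, ← pow_mul,
      ← pow_mul]
    calc (1.02 : ℝ) ^ (n * 2) = (1.02 ^ 2) ^ n := by rw [mul_comm, pow_mul]
      _ ≤ (2 ^ 2 * 0.64 ^ 3) ^ n := by gcongr; norm_num
      _ = 2 ^ (n * 2) * 0.64 ^ (3 * n) := by rw [mul_pow, ← pow_mul, ← pow_mul, mul_comm 2 n]
      _ ≤ 2 ^ (n * 2) * 0.64 ^ ((n + n / 2) * 2) := by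
        gcongr 2 ^ (n * 2) * ?_
        apply pow_le_pow_of_le_one (by norm_num) (by norm_num)
        omega

lemma T1_k {x0 : ℝ} (h0 : 0.7 < x0) (h1 : x0 < 1) (k : ℕ) (hk : 0 < k) (h2 : 1 / 2 < x0 ^ k) (h3 : x0 ^ k ≤ 0.649) :
    ∃ ε > 0, T1 (Icc (x0 - ε) (x0 + ε)) := by
  have h4 : ∀ᶠ y in 𝓝 x0, 1 / 2 < y ^ k := (continuous_pow k).continuousAt.eventually (lt_mem_nhds h2)
  have h5 : ∀ᶠ y in 𝓝 x0, (0.7 : ℝ) < y := lt_mem_nhds h0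
  obtain ⟨a0, ⟨h6, h7⟩, h8⟩ : ∃ a0, (1 / 2 < a0 ^ k ∧ 0.7 < a0) ∧ a0 < x0 := by
    have := ((h4.and h5).filter_mono nhdsWithin_le_nhds).and (self_mem_nhdsWithin (a := x0) (s := Iio x0))
    exact this.exists
  have hm : StrictMono (fun j : ℕ => k * j) := fun a b hab => Nat.mul_lt_mul_of_pos_left hab hk
  refine T1_loc (t := fun j => k * j) (e := fun j => k * j) (e' := fun j => k * j)
    hm hm hm ?_ (a0 := a0) (by linarith) h8 h1 ?_
    (nodz_k k hk (by linarith) h3) (nodz_k k hk (by linarith) h3)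
  · intro n; left; ext j
    simp [mul_add]
  · have hb : Summable (fun n : ℕ => ((2 * a0 ^ k)⁻¹) ^ n) :=
      summable_geometric_of_lt_one (by have : 0 < a0 := by linarith
                                       positivity) (inv_lt_one_of_one_lt₀ (by linarith))
    refine hb.congr fun n => ?_
    rw [inv_pow, mul_pow, ← pow_mul]

lemma T1_all {x0 : ℝ} (h0 : 0.649 ≤ x0) (h1 : x0 < 1) : ∃ ε > 0, T1 (Icc (x0 - ε) (x0 + ε)) := by
  by_cases h : x0 ≤ 0.7072
  · exact T1_T3 h0 h
  push Not at h
  have hex : ∃ n, x0 ^ n ≤ 1 / 2 := by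
    obtain ⟨n, hn⟩ := exists_pow_lt_of_lt_one (show (0 : ℝ) < 1 / 2 by norm_num) h1
    exact ⟨n, hn.le⟩
  classical
  have hn := Nat.find_spec hex
  have hmin := fun m hm => Nat.find_min hex (m := m) hm
  set n := Nat.find hex
  have hn3 : 3 ≤ n := by
    by_contra hc
    have : n = 0 ∨ n = 1 ∨ n = 2 := by omega
    rcases this with h' | h' | h' <;> rw [h'] at hn
    · norm_num at hn
    · norm_num at hn; linarith
    · nlinarith
  obtain ⟨k, hk⟩ : ∃ k, n = k + 1 := ⟨n - 1, by omega⟩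
  have h2 : 1 / 2 < x0 ^ k := not_le.1 (hmin k (by omega))
  rw [hk] at hn
  refine T1_k (by linarith) h1 k (by omega) h2 ?_
  by_contra hc
  push Not at hc
  have hx0 : 0 < x0 := by linarith
  have h3 : (x0 ^ k) ^ 3 ≤ (x0 ^ (k + 1)) ^ 2 := by
    rw [← pow_mul, ← pow_mul]
    exact pow_le_pow_of_le_one hx0.le h1.le (by omega)
  have h4 : (x0 ^ (k + 1)) ^ 2 ≤ (1 / 2) ^ 2 := by gcongr
  have h5 : (0.649 : ℝ) ^ 3 ≤ (x0 ^ k) ^ 3 := by gcongr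
  norm_num at h4 h5
  linarith


/-- geometric decay -/
def GD (c : ℕ → ℝ) : Prop := ∃ C s : ℝ, 0 < s ∧ s < 1 ∧ ∀ n, |c n| ≤ C * s ^ n

/-- value of power series -/
def Ev (c : ℕ → ℝ) (x : ℝ) : ℝ := ∑' n, c n * x ^ n
/-- Euler derivative of power series -/
def Dv (c : ℕ → ℝ) (x : ℝ) : ℝ := ∑' n : ℕ, (n : ℝ) * (c n * x ^ n)

lemma GD.dsum {c : ℕ → ℝ} (h : GD c) {x : ℝ} (hx : |x| ≤ 1) :
    Summable (fun n : ℕ => (n : ℝ) * (c n * x ^ n)) := by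
  obtain ⟨C, s, h0, h1, hb⟩ := h
  have h2 : Summable (fun n : ℕ => (n : ℝ) ^ 1 * s ^ n) :=
    summable_pow_mul_geometric_of_norm_lt_one 1 (by rwa [Real.norm_of_nonneg h0.le])
  refine Summable.of_norm_bounded (h2.mul_left C) fun n => ?_
  rw [norm_mul, norm_mul, norm_pow, Real.norm_eq_abs, Real.norm_eq_abs, Real.norm_eq_abs, Nat.abs_cast]
  have h3 : |x| ^ n ≤ 1 := pow_le_one₀ (abs_nonneg _) hx
  calc (n : ℝ) * (|c n| * |x| ^ n) ≤ n * (C * s ^ n * 1) := by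
        gcongr
        · exact (abs_nonneg _).trans (hb n)
        · exact hb n
    _ = _ := by ring

lemma GD.esum {c : ℕ → ℝ} (h : GD c) {x : ℝ} (hx : |x| ≤ 1) :
    Summable (fun n : ℕ => c n * x ^ n) := by
  obtain ⟨C, s, h0, h1, hb⟩ := h
  refine Summable.of_norm_bounded ((summable_geometric_of_lt_one h0.le h1).mul_left C) fun n => ?_
  rw [norm_mul, norm_pow, Real.norm_eq_abs, Real.norm_eq_abs]
  have h3 : |x| ^ n ≤ 1 := pow_le_one₀ (abs_nonneg _) hx
  calc |c n| * |x| ^ n ≤ C * s ^ n * 1 := by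
        gcongr
        · exact (abs_nonneg _).trans (hb n)
        · exact hb n
    _ = _ := by ring

lemma GD.sq {c : ℕ → ℝ} (h : GD c) : Summable (fun n : ℕ => c n ^ 2) := by
  obtain ⟨C, s, h0, h1, hb⟩ := h
  have : Summable (fun n : ℕ => C ^ 2 * (s ^ 2) ^ n) :=
    (summable_geometric_of_lt_one (by positivity) (by nlinarith)).mul_left _
  refine Summable.of_nonneg_of_le (fun n => by positivity) (fun n => ?_) this
  rw [← sq_abs]
  calc |c n| ^ 2 ≤ (C * s ^ n) ^ 2 := by gcongr; exact hb n
    _ = _ := by ring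

lemma blaschke {c : ℕ → ℝ} (hc : GD c) {α : ℝ} (h0 : 0 < α) (h1 : α < 1) (hz : Ev c α = 0) :
    ∃ c' : ℕ → ℝ, GD c' ∧ α * c' 0 = - c 0 ∧ ∑' n, c' n ^ 2 = ∑' n, c n ^ 2 ∧
      (Dv c α = 0 → Ev c' α = 0) ∧
      ∀ β, 0 < β → β < 1 → β ≠ α → Ev c β = 0 → Ev c' β = 0 ∧ (Dv c β = 0 → Dv c' β = 0) := by
  obtain ⟨C, s, hs0, hs1, hb⟩ := id hc
  have hC : 0 ≤ C := by have := (abs_nonneg _).trans (hb 0); simpa using this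
  set k : ℕ → ℝ := fun n => ∑' i, c (n + 1 + i) * α ^ i with hkd
  have hbd : ∀ n i, ‖c (n + 1 + i) * α ^ i‖ ≤ C * s ^ n * s ^ i := by
    intro n i
    rw [norm_mul, norm_pow, Real.norm_eq_abs, Real.norm_eq_abs, abs_of_pos h0]
    calc |c (n + 1 + i)| * α ^ i ≤ (C * s ^ (n + 1 + i)) * 1 := by
          gcongr
          · exact hb _
          · exact pow_le_one₀ h0.le h1.le
      _ = C * s ^ n * s ^ i * s := by ring
      _ ≤ C * s ^ n * s ^ i * 1 := by gcongr
      _ = _ := by ring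
  have hgs : Summable (fun i : ℕ => s ^ i) := summable_geometric_of_lt_one hs0.le hs1
  have hks : ∀ n, Summable (fun i => c (n + 1 + i) * α ^ i) := fun n =>
    Summable.of_norm_bounded (hgs.mul_left _) (hbd n)
  have hkrec : ∀ n, k n = c (n + 1) + α * k (n + 1) := by
    intro n
    simp only [hkd]
    rw [(hks n).tsum_eq_zero_add, ← tsum_mul_left]
    congr 1
    · simp
    · congr 1; ext i
      rw [show n + 1 + (i + 1) = n + 1 + 1 + i by ring]; ring
  have hk0 : c 0 = - α * k 0 := by
    have := (hc.esum (x := α) (by rw [abs_of_pos h0]; exact h1.le)).tsum_eq_zero_add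
    unfold Ev at hz
    rw [hz] at this
    have h2 : α * k 0 = ∑' b, c (b + 1) * α ^ (b + 1) := by
      simp only [hkd]
      rw [← tsum_mul_left]; congr 1; ext i
      rw [show 0 + 1 + i = i + 1 by ring]; ring
    rw [← h2] at this
    simp at this; linarith
  set C1 := C * (1 - s)⁻¹ with hC1
  have hC10 : 0 ≤ C1 := mul_nonneg hC (inv_nonneg.2 (by linarith))
  have hkb : ∀ n, |k n| ≤ C1 * s ^ n := by
    intro n
    have := tsum_of_norm_bounded ((hgs.mul_left (C * s ^ n)).hasSum) (hbd n)
    rw [tsum_mul_left, tsum_geometric_of_lt_one hs0.le hs1, Real.norm_eq_abs] at this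
    calc _ ≤ _ := this
      _ = _ := by rw [hC1]; ring
  have hkG : GD k := ⟨C1, s, hs0, hs1, hkb⟩
  set c' : ℕ → ℝ := fun n => k n - α * (if n = 0 then 0 else k (n - 1)) with hc'
  have hc'0 : c' 0 = k 0 := by simp [hc']
  have hc's : ∀ n, c' (n + 1) = k (n + 1) - α * k n := by intro n; simp [hc']
  have hcs : ∀ n, c (n + 1) = k n - α * k (n + 1) := by intro n; rw [hkrec n]; ring
  have hc'G : GD c' := by
    refine ⟨C1 + C1 / s, s, hs0, hs1, fun n => ?_⟩
    rcases n with _ | n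
    · rw [hc'0]
      have := hkb 0
      have h3 : 0 ≤ C1 / s := by positivity
      simp at this ⊢; linarith
    · rw [hc's]
      calc |k (n + 1) - α * k n| ≤ |k (n + 1)| + |α * k n| := abs_sub _ _
        _ ≤ C1 * s ^ (n + 1) + 1 * (C1 * s ^ n) := by
          rw [abs_mul, abs_of_pos h0]
          gcongr
          · exact hkb _
          · exact hkb _
        _ = _ := by field_simp; ring
  have hEc : ∀ x, |x| ≤ 1 → Ev c x = (x - α) * Ev k x := by
    intro x hx
    have e1 := hkG.esum hx
    unfold Ev
    rw [(hc.esum hx).tsum_eq_zero_add]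
    have h2 : ∑' n, c (n + 1) * x ^ (n + 1) = x * ∑' n, k n * x ^ n - α * ∑' n, k (n + 1) * x ^ (n + 1) := by
      rw [← tsum_mul_left, ← tsum_mul_left,
        ← (e1.mul_left x).tsum_sub (((summable_nat_add_iff 1).2 e1).mul_left α)]
      congr 1; ext n; rw [hcs]; ring
    have h3 := e1.tsum_eq_zero_add
    rw [h2, h3, hk0]
    rw [h3.symm, show ∑' n, k (n + 1) * x ^ (n + 1) = ∑' n, k n * x ^ n - k 0 * x ^ 0 by rw [h3]; ring]
    ring
  have hEc' : ∀ x, |x| ≤ 1 → Ev c' x = (1 - α * x) * Ev k x := by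
    intro x hx
    have e1 := hkG.esum hx
    unfold Ev
    rw [(hc'G.esum hx).tsum_eq_zero_add]
    have h2 : ∑' n, c' (n + 1) * x ^ (n + 1) = ∑' n, k (n + 1) * x ^ (n + 1) - α * x * ∑' n, k n * x ^ n := by
      rw [← tsum_mul_left, ← ((summable_nat_add_iff 1).2 e1).tsum_sub (e1.mul_left (α * x))]
      congr 1; ext n; rw [hc's]; ring
    have h3 := e1.tsum_eq_zero_add
    rw [h2, hc'0]
    rw [show ∑' n, k (n + 1) * x ^ (n + 1) = ∑' n, k n * x ^ n - k 0 * x ^ 0 by rw [h3]; ring]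
    ring
  have hDsh : ∀ x, |x| ≤ 1 → ∑' n : ℕ, ((n + 1 : ℕ) : ℝ) * (k (n + 1) * x ^ (n + 1)) = Dv k x := by
    intro x hx
    unfold Dv
    rw [(hkG.dsum hx).tsum_eq_zero_add]; simp
  have hDp : ∀ x, |x| ≤ 1 → ∑' n : ℕ, ((n + 1 : ℕ) : ℝ) * (k n * x ^ n) = Dv k x + Ev k x := by
    intro x hx
    unfold Dv Ev
    rw [← (hkG.dsum hx).tsum_add (hkG.esum hx)]
    congr 1; ext n; push_cast; ring
  have hDps : ∀ x, |x| ≤ 1 → Summable (fun n : ℕ => ((n + 1 : ℕ) : ℝ) * (k n * x ^ n)) := by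
    intro x hx
    refine ((hkG.dsum hx).add (hkG.esum hx)).congr fun n => by push_cast; ring
  have hDss : ∀ x, |x| ≤ 1 → Summable (fun n : ℕ => ((n + 1 : ℕ) : ℝ) * (k (n + 1) * x ^ (n + 1))) :=
    fun x hx => (summable_nat_add_iff 1).2 (hkG.dsum hx)
  have hDc : ∀ x, |x| ≤ 1 → Dv c x = x * (Dv k x + Ev k x) - α * Dv k x := by
    intro x hx
    have e0 : Dv c x = ∑' n : ℕ, ((n + 1 : ℕ) : ℝ) * (c (n + 1) * x ^ (n + 1)) := by
      unfold Dv
      rw [(hc.dsum hx).tsum_eq_zero_add]; simp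
    rw [e0, ← hDp x hx]
    conv_rhs => rw [← hDsh x hx]
    rw [← tsum_mul_left, ← tsum_mul_left, ← ((hDps x hx).mul_left x).tsum_sub ((hDss x hx).mul_left α)]
    congr 1; ext n; rw [hcs]; ring
  have hDc' : ∀ x, |x| ≤ 1 → Dv c' x = Dv k x - α * x * (Dv k x + Ev k x) := by
    intro x hx
    have e0 : Dv c' x = ∑' n : ℕ, ((n + 1 : ℕ) : ℝ) * (c' (n + 1) * x ^ (n + 1)) := by
      unfold Dv
      rw [(hc'G.dsum hx).tsum_eq_zero_add]; simp
    rw [e0, ← hDp x hx]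
    conv_rhs => rw [← hDsh x hx]
    rw [← tsum_mul_left, ← (hDss x hx).tsum_sub ((hDps x hx).mul_left (α * x))]
    congr 1; ext n; rw [hc's]; ring
  have habs : ∀ x : ℝ, 0 < x → x < 1 → |x| ≤ 1 := fun x hx hx1 => by rw [abs_of_pos hx]; exact hx1.le
  refine ⟨c', hc'G, by rw [hc'0, hk0]; ring, ?_, ?_, ?_⟩
  · have hq := hkG.sq
    have hq1 := (summable_nat_add_iff 1).2 hq
    have h3 := hq.tsum_eq_zero_add
    rw [hc'G.sq.tsum_eq_zero_add, hc.sq.tsum_eq_zero_add]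
    have h4 : ∑' n, c' (n + 1) ^ 2 - ∑' n, c (n + 1) ^ 2 =
        (1 - α ^ 2) * (∑' n, k (n + 1) ^ 2 - ∑' n, k n ^ 2) := by
      rw [← ((summable_nat_add_iff 1).2 hc'G.sq).tsum_sub ((summable_nat_add_iff 1).2 hc.sq),
        ← hq1.tsum_sub hq, ← tsum_mul_left]
      congr 1; ext n; rw [hcs, hc's]; ring
    rw [hc'0, hk0]
    have h5 : ∑' n, k (n + 1) ^ 2 - ∑' n, k n ^ 2 = - k 0 ^ 2 := by rw [h3]; ring
    rw [h5] at h4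
    linear_combination h4
  · intro hD
    rw [hDc α (habs _ h0 h1)] at hD
    have : Ev k α = 0 := by
      have h6 : α * Ev k α = 0 := by linarith
      exact (mul_eq_zero.1 h6).resolve_left h0.ne'
    rw [hEc' α (habs _ h0 h1), this, mul_zero]
  · intro β hβ0 hβ1 hne hE
    have hab := habs _ hβ0 hβ1
    rw [hEc β hab] at hE
    have hk : Ev k β = 0 := (mul_eq_zero.1 hE).resolve_left (sub_ne_zero.2 hne)
    refine ⟨by rw [hEc' β hab, hk, mul_zero], fun hD => ?_⟩
    rw [hDc β hab, hk] at hD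
    have h7 : (β - α) * Dv k β = 0 := by linarith
    have hkD : Dv k β = 0 := (mul_eq_zero.1 h7).resolve_left (sub_ne_zero.2 hne)
    rw [hDc' β hab, hk, hkD]; ring

lemma hardy {x y : ℝ} (hx : 0 < x) (hxy : x < y) (hy : y ^ 2 < 4 / 5) (p : EE) (hp : p.1 0 ≠ p.2 0)
    (h1 : FF (fun j => j) x p = 0) (h2 : HH (fun j => j) x p = 0)
    (h3 : FF (fun j => j) y p = 0) (h4 : HH (fun j => j) y p = 0) :
    256 / 3125 ≤ (x * y) ^ 4 := by
  set r := √(4 / 5 : ℝ) with hr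
  have hr2 : r ^ 2 = 4 / 5 := Real.sq_sqrt (by norm_num)
  have hr0 : 0 < r := Real.sqrt_pos.2 (by norm_num)
  have hr1 : r < 1 := by nlinarith
  have hyr : y < r := by nlinarith
  set c : ℕ → ℝ := fun n => dd p n * r ^ n with hcd
  have hb : ∀ n, |c n| ≤ 1 * r ^ n := by
    intro n
    rw [hcd]; simp only [abs_mul, abs_pow, abs_of_pos hr0]
    gcongr; exact dd_abs p n
  have hc : GD c := ⟨1, r, hr0, hr1, hb⟩
  have hE : ∀ z, Ev c (z / r) = FF (fun j => j) z p := by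
    intro z
    unfold Ev FF
    congr 1; ext n
    simp only [hcd, div_pow]; field_simp
  have hD : ∀ z, Dv c (z / r) = HH (fun j => j) z p := by
    intro z
    unfold Dv HH
    congr 1; ext n
    simp only [hcd, div_pow]; field_simp
  set a := x / r with had
  set b := y / r with hbd
  have ha0 : 0 < a := by positivity
  have hab : a < b := by rw [had, hbd]; gcongr
  have hb1 : b < 1 := (div_lt_one hr0).2 hyr
  have ha1 := hab.trans hb1
  have hb0 := ha0.trans hab
  obtain ⟨c1, g1, z1, s1, d1, k1⟩ := blaschke hc ha0 ha1 (by rw [hE, h1])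
  obtain ⟨k1a, k1b⟩ := k1 b hb0 hb1 hab.ne' (by rw [hE, h3])
  obtain ⟨c2, g2, z2, s2, d2, k2⟩ := blaschke g1 ha0 ha1 (d1 (by rw [hD, h2]))
  obtain ⟨k2a, k2b⟩ := k2 b hb0 hb1 hab.ne' k1a
  obtain ⟨c3, g3, z3, s3, d3, k3⟩ := blaschke g2 hb0 hb1 k2a
  obtain ⟨c4, g4, z4, s4, d4, k4⟩ := blaschke g3 hb0 hb1 (d3 (k2b (k1b (by rw [hD, h4]))))
  have hc0 : c 0 ^ 2 = 1 := by
    rw [hcd]; simp only [pow_zero, mul_one]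
    rw [← sq_abs, dd_abs_eq p 0 hp]; norm_num
  have hle : c4 0 ^ 2 ≤ 5 := by
    calc c4 0 ^ 2 ≤ ∑' n, c4 n ^ 2 := g4.sq.le_tsum 0 (fun j _ => sq_nonneg _)
      _ = ∑' n, c n ^ 2 := by rw [s4, s3, s2, s1]
      _ ≤ ∑' n : ℕ, (4 / 5 : ℝ) ^ n := by
        apply hc.sq.tsum_le_tsum _ (summable_geometric_of_lt_one (by norm_num) (by norm_num))
        intro n
        rw [← hr2, ← sq_abs, ← pow_mul, mul_comm, pow_mul]
        gcongr
        simpa using hb n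
      _ = 5 := by rw [tsum_geometric_of_lt_one (by norm_num) (by norm_num)]; norm_num
  have h5 : c 0 = (a * b) ^ 2 * c4 0 := by
    have : c 0 = a * (a * (b * (b * c4 0))) := by rw [z4, mul_neg, z3, neg_neg, z2, mul_neg, z1]; ring
    rw [this]; ring
  have h6 : 1 ≤ (a * b) ^ 4 * 5 := by
    rw [← hc0, h5]
    calc _ = (a * b) ^ 4 * c4 0 ^ 2 := by ring
      _ ≤ _ := by gcongr
  have h7 : (a * b) ^ 4 * (256 / 625) = (x * y) ^ 4 := by
    have hr8 : r ^ 8 = 256 / 625 := by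
      rw [show (8 : ℕ) = 2 * 4 by norm_num, pow_mul, hr2]; norm_num
    rw [← hr8, had, hbd]; field_simp
  rw [← h7]; linarith


/-- length of the sublevel set -/
def fl (a b r : ℝ) (p : EE) : ℝ≥0∞ := volume {x | x ∈ Icc a b ∧ |FF (fun j => j) x p| < r}

lemma fl_meas {a b : ℝ} (ha : 0 < a) (hb : b < 1) (r : ℝ) : Measurable (fl a b r) :=
  measurable_measure_prodMk_right (μ := (volume : Measure ℝ)) (Smeas id_mono ha hb r)

lemma ident_sh (n : ℕ) : (fun j : ℕ => n + j - n) = (fun j => j) := by ext j; omega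

lemma FF_sh {x : ℝ} (hx : |x| < 1) (n : ℕ) {p : EE} (hp : p ∈ Pre n) :
    FF (fun j => j) x p = x ^ n * FF (fun j => j) x (shn n p) := by
  have := FF_shift id_mono hx n hp
  rwa [ident_sh n] at this

lemma intPre {a b C : ℝ} (ha : 0 < a) (hb : b < 1)
    (hC : ∀ r > 0, ∫⁻ x in Icc a b, PP {p | |FF (fun j => j) x p| < r} ≤ ENNReal.ofReal (C * r))
    (n : ℕ) {r : ℝ} (hr : 0 < r) :
    ∫⁻ p in Pre n, fl a b r p ∂PP ≤ (2 : ℝ≥0∞)⁻¹ ^ n * ENNReal.ofReal (C * (r / a ^ n)) := by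
  have hm : Measurable (shn n) := by unfold shn; fun_prop
  have hle : ∫⁻ p in Pre n, fl a b r p ∂PP ≤ ∫⁻ p in Pre n, fl a b (r / a ^ n) (shn n p) ∂PP := by
    apply setLIntegral_mono' (Pre_meas n)
    intro p hp
    apply measure_mono
    rintro x ⟨hx, hxr⟩
    refine ⟨hx, ?_⟩
    have hx0 : 0 < x := ha.trans_le hx.1
    rw [FF_sh (by rw [abs_of_pos hx0]; linarith [hx.2]) n hp, abs_mul, abs_pow, abs_of_pos hx0] at hxr
    rw [lt_div_iff₀ (by positivity), mul_comm]
    refine lt_of_le_of_lt ?_ hxr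
    gcongr
    exact hx.1
  have hmap : (PP.restrict (Pre n)).map (shn n) = (2 : ℝ≥0∞)⁻¹ ^ n • PP := by
    ext B hB
    rw [Measure.map_apply hm hB, Measure.restrict_apply (hm hB), Measure.smul_apply, smul_eq_mul,
      ← PP_Pre_shn n hB]
    congr 1
    ext p; simp [and_comm]
  refine hle.trans ?_
  rw [← lintegral_map (fl_meas ha hb _) hm, hmap, lintegral_smul_measure, smul_eq_mul]
  gcongr
  have := hC (r / a ^ n) (by positivity)
  rw [tonelli1 id_mono ha hb] at this
  exact this

lemma half {a b C a1 K : ℝ} (ha : 0 < a) (hb : b < 1) (ha1 : 0 < a1) (hK : 0 ≤ K) (h2 : 1 < 2 * (a1 * a))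
    (hC : ∀ r > 0, ∫⁻ x in Icc a b, PP {p | |FF (fun j => j) x p| < r} ≤ ENNReal.ofReal (C * r)) :
    ∃ C' : ℝ, 0 ≤ C' ∧ ∀ r > 0,
      ∫⁻ p, ∑' n, (Pre n).indicator (fun p => ENNReal.ofReal (K * r / a1 ^ n) * fl a b r p) p ∂PP ≤
        ENNReal.ofReal (C' * r ^ 2) := by
  set D := max C 0 with hD
  have hD0 : 0 ≤ D := le_max_right _ _
  have hgs : Summable (fun n : ℕ => ((2 * (a1 * a))⁻¹) ^ n) :=
    summable_geometric_of_lt_one (by positivity) (inv_lt_one_of_one_lt₀ h2)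
  refine ⟨K * D * ∑' n : ℕ, ((2 * (a1 * a))⁻¹) ^ n, by positivity, fun r hr => ?_⟩
  have hfm : ∀ n : ℕ, Measurable (fun p => ENNReal.ofReal (K * r / a1 ^ n) * fl a b r p) :=
    fun n => (fl_meas ha hb r).const_mul _
  rw [lintegral_tsum (fun n => ((hfm n).indicator (Pre_meas n)).aemeasurable)]
  calc _ ≤ ∑' n : ℕ, ENNReal.ofReal (K * D * r ^ 2 * ((2 * (a1 * a))⁻¹) ^ n) := by
        apply ENNReal.tsum_le_tsum
        intro n
        rw [lintegral_indicator (Pre_meas n), lintegral_const_mul _ (fl_meas ha hb r)]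
        calc _ ≤ ENNReal.ofReal (K * r / a1 ^ n) * ((2 : ℝ≥0∞)⁻¹ ^ n * ENNReal.ofReal (D * (r / a ^ n))) := by
              gcongr
              refine (intPre ha hb hC n hr).trans ?_
              gcongr
              exact le_max_left _ _
          _ = _ := by
              rw [show (2 : ℝ≥0∞)⁻¹ ^ n = ENNReal.ofReal ((2 : ℝ)⁻¹ ^ n) by
                rw [ENNReal.ofReal_pow (by norm_num), ENNReal.ofReal_inv_of_pos (by norm_num)]; simp,
                ← ENNReal.ofReal_mul (by positivity), ← ENNReal.ofReal_mul (by positivity)]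
              congr 1
              rw [inv_pow, inv_pow, mul_pow, mul_pow]
              field_simp
    _ = _ := by
        rw [← ENNReal.ofReal_tsum_of_nonneg (fun n => by positivity) (hgs.mul_left _), tsum_mul_left]
        congr 1; ring

/-- two dimensional correlation -/
def E2 (r : ℝ) (q : ℝ × ℝ) : ℝ≥0∞ :=
  PP {p | |FF (fun j => j) q.1 p| < r ∧ |FF (fun j => j) q.2 p| < r}

lemma S2meas {a b a' b' : ℝ} (ha : 0 < a) (hb : b < 1) (ha' : 0 < a') (hb' : b' < 1) (r : ℝ) :
    MeasurableSet {z : (ℝ × ℝ) × EE | (z.1.1 ∈ Icc a b ∧ |FF (fun j => j) z.1.1 z.2| < r) ∧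
      (z.1.2 ∈ Icc a' b' ∧ |FF (fun j => j) z.1.2 z.2| < r)} := by
  have h1 : Measurable (fun z : (ℝ × ℝ) × EE => (z.1.1, z.2)) := by fun_prop
  have h2 : Measurable (fun z : (ℝ × ℝ) × EE => (z.1.2, z.2)) := by fun_prop
  exact (h1 (Smeas id_mono ha hb r)).inter (h2 (Smeas id_mono ha' hb' r))

lemma tonelli2 {a b a' b' : ℝ} (ha : 0 < a) (hb : b < 1) (ha' : 0 < a') (hb' : b' < 1) (r : ℝ) :
    ∫⁻ q in Icc a b ×ˢ Icc a' b', E2 r q = ∫⁻ p, fl a b r p * fl a' b' r p ∂PP := by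
  have hS := S2meas ha hb ha' hb' r
  have h1 := Measure.prod_apply (μ := (volume : Measure (ℝ × ℝ))) (ν := PP) hS
  have h2 := Measure.prod_apply_symm (μ := (volume : Measure (ℝ × ℝ))) (ν := PP) hS
  rw [h1] at h2
  rw [← lintegral_indicator (measurableSet_Icc.prod measurableSet_Icc)]
  refine Eq.trans ?_ (h2.trans ?_)
  · apply lintegral_congr
    intro q
    by_cases hq : q ∈ Icc a b ×ˢ Icc a' b'
    · rw [indicator_of_mem hq]
      obtain ⟨hq1, hq2⟩ := hq
      unfold E2
      congr 1
      ext p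
      simp only [mem_preimage, mem_ofPred_eq]
      tauto
    · rw [indicator_of_notMem hq]
      symm
      convert measure_empty (μ := PP)
      ext p
      simp only [mem_preimage, mem_ofPred_eq, mem_empty_iff_false, iff_false]
      intro h
      exact hq ⟨h.1.1, h.2.1⟩
  · apply lintegral_congr
    intro p
    unfold fl
    rw [← Measure.prod_prod]
    rfl

lemma fl_bd {x0 ε δ : ℝ} (hδ : 0 < δ) (hε : 0 < ε) (hε1 : 2 * ε ≤ 1)
    (ha : 0 < x0 - ε) (hb : x0 + ε < 1) (n : ℕ) {p : EE} (hp : p ∈ Pre n)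
    (hA : AA (fun j => j) x0 ε δ (shn n p)) (r : ℝ) :
    fl (x0 - ε) (x0 + ε) r p ≤ ENNReal.ofReal (2 / δ * r / (x0 - ε) ^ n) := by
  have := subl id_mono hδ hε hε1 ha hb hA n r
  refine le_trans (measure_mono ?_) (this.trans (le_of_eq ?_))
  · rintro x ⟨hx, hxr⟩
    refine ⟨hx, ?_⟩
    rwa [← FF_sh (by rw [abs_lt]; constructor <;> linarith [hx.1, hx.2]) n hp]
  · congr 1; field_simp

lemma est2 {x0 y0 ε δ : ℝ} (hδ : 0 < δ) (hε : 0 < ε) (hε1 : 2 * ε ≤ 1)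
    (ha : 0 < x0 - ε) (hb : x0 + ε < 1) (ha' : 0 < y0 - ε) (hb' : y0 + ε < 1)
    (h2 : 1 < 2 * ((x0 - ε) * (y0 - ε)))
    (hJ : T1 (Icc (y0 - ε) (y0 + ε)))
    (hA : (∀ p : EE, p.1 0 ≠ p.2 0 → AA (fun j => j) x0 ε δ p) ∨
      (T1 (Icc (x0 - ε) (x0 + ε)) ∧
        ∀ p : EE, p.1 0 ≠ p.2 0 → AA (fun j => j) x0 ε δ p ∨ AA (fun j => j) y0 ε δ p)) :
    ∃ C : ℝ, ∀ r > 0, ∫⁻ q in Icc (x0 - ε) (x0 + ε) ×ˢ Icc (y0 - ε) (y0 + ε), E2 r q ≤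
      ENNReal.ofReal (C * r ^ 2) := by
  obtain ⟨CJ, hCJ⟩ := hJ
  obtain ⟨C1, hC10, hC1⟩ := half (K := 2 / δ) ha' hb' ha (by positivity) h2 hCJ
  rcases hA with hA | ⟨⟨CI, hCI⟩, hA⟩
  · refine ⟨C1, fun r hr => ?_⟩
    rw [tonelli2 ha hb ha' hb']
    refine le_trans (lintegral_mono_ae ?_) (hC1 r hr)
    filter_upwards [ae_cover] with p hp
    obtain ⟨n, hn, hn0⟩ := hp
    refine le_trans ?_ (ENNReal.le_tsum n)
    rw [indicator_of_mem hn]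
    gcongr
    exact fl_bd hδ hε hε1 ha hb n hn (hA _ hn0) r
  · obtain ⟨C2, hC20, hC2⟩ := half (K := 2 / δ) ha hb ha' (by positivity) (by rwa [mul_comm (y0 - ε)]) hCI
    refine ⟨C1 + C2, fun r hr => ?_⟩
    rw [tonelli2 ha hb ha' hb', add_mul, ENNReal.ofReal_add (by positivity) (by positivity)]
    refine le_trans ?_ (add_le_add (hC1 r hr) (hC2 r hr))
    rw [← lintegral_add_left]
    · apply lintegral_mono_ae
      filter_upwards [ae_cover] with p hp
      obtain ⟨n, hn, hn0⟩ := hp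
      rcases hA _ hn0 with h | h
      · refine le_trans ?_ le_self_add
        refine le_trans ?_ (ENNReal.le_tsum n)
        rw [indicator_of_mem hn]
        gcongr
        exact fl_bd hδ hε hε1 ha hb n hn h r
      · refine le_trans ?_ le_add_self
        refine le_trans ?_ (ENNReal.le_tsum n)
        rw [indicator_of_mem hn, mul_comm]
        gcongr
        exact fl_bd hδ hε hε1 ha' hb' n hn h r
    · refine Measurable.ennreal_tsum fun n => ?_
      have hfm : Measurable (fun p => ENNReal.ofReal (2 / δ * r / (x0 - ε) ^ n) * fl (y0 - ε) (y0 + ε) r p) :=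
        (fl_meas ha' hb' r).const_mul _
      exact hfm.indicator (Pre_meas n)

lemma bconst : (4 * (5 : ℝ) ^ (-(5 : ℝ) / 4)) ^ 4 = 256 / 3125 := by
  rw [mul_pow, ← Real.rpow_natCast, ← Real.rpow_natCast, ← Real.rpow_mul (by norm_num)]
  norm_num

lemma est_loc {q0 : ℝ × ℝ} (hq : q0 ∈ regS) :
    ∃ ε > 0, 0 < q0.1 - ε ∧ q0.1 + ε < 1 ∧ 0 < q0.2 - ε ∧ q0.2 + ε < 1 ∧
      ∃ C : ℝ, ∀ r > 0, ∫⁻ q in Icc (q0.1 - ε) (q0.1 + ε) ×ˢ Icc (q0.2 - ε) (q0.2 + ε), E2 r q ≤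
      ENNReal.ofReal (C * r ^ 2) := by
  obtain ⟨x0, y0⟩ := q0
  have hbase : 0 < x0 ∧ x0 < y0 ∧ y0 < 1 ∧ 1 / 2 < x0 * y0 ∧
      (x0 < 0.649 ∨ (0.649 ≤ x0 ∧ (x0 * y0) ^ 4 < 256 / 3125)) := by
    rcases hq with ⟨h1, h2, h3, _, h5, h6⟩ | ⟨⟨h1, h2, h3, _, h5, _⟩, h6⟩
    · refine ⟨h1, h2, h3, h5, ?_⟩
      by_cases h : x0 < 0.649
      · exact Or.inl h
      · refine Or.inr ⟨not_lt.1 h, ?_⟩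
        rw [← bconst]
        simp only at h1 h2 h6
        have : 0 < x0 * y0 := by positivity
        gcongr
    · exact ⟨h1, h2, h3, h5, Or.inl h6⟩
  obtain ⟨h1, h2, h3, h4, h5⟩ := hbase
  simp only
  have hy : 0 < y0 := h1.trans h2
  have hx1 : |x0| < 1 := by rw [abs_of_pos h1]; linarith
  have hy1 : |y0| < 1 := by rw [abs_of_pos hy]; linarith
  have hy649 : 0.649 ≤ y0 := by
    rcases h5 with h5 | h5
    · nlinarith
    · linarith [h5.1]
  obtain ⟨e1, he1, hT1⟩ := T1_all hy649 h3
  rcases h5 with h5 | ⟨h5, h6⟩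
  · obtain ⟨e2, he2, δ, hδ, hh⟩ := trans2 id_mono hx1 hx1
      (fun p hp => Or.inl (toG (nodz_id h1 h5.le p hp)))
    obtain ⟨ε, hε, l1, l2, l3, l4, l5⟩ : ∃ ε > 0, ε ≤ e1 ∧ ε ≤ e2 ∧ ε < x0 ∧ 2 * ε < 1 - y0 ∧
        2 * ε < x0 * y0 - 1 / 2 := by
      refine ⟨min (min e1 e2) (min (x0 / 2) (min ((1 - y0) / 4) ((x0 * y0 - 1 / 2) / 4))), ?_, ?_⟩
      · refine lt_min (lt_min he1 he2) (lt_min (by linarith) (lt_min (by linarith) (by linarith)))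
      · have m1 := min_le_left (min e1 e2) (min (x0 / 2) (min ((1 - y0) / 4) ((x0 * y0 - 1 / 2) / 4)))
        have m2 := min_le_right (min e1 e2) (min (x0 / 2) (min ((1 - y0) / 4) ((x0 * y0 - 1 / 2) / 4)))
        have m3 := m2.trans (min_le_left _ _)
        have m4 := m2.trans (min_le_right _ _)
        have m5 := m4.trans (min_le_left _ _)
        have m6 := m4.trans (min_le_right _ _)
        refine ⟨m1.trans (min_le_left _ _), m1.trans (min_le_right _ _), ?_, ?_, ?_⟩ <;> linarith
    refine ⟨ε, hε, by linarith, by linarith, by linarith, by linarith, ?_⟩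
    refine est2 hδ hε (by linarith) (by linarith) (by linarith) (by linarith) (by linarith) ?_
      (hT1.mono (Icc_subset_Icc (by linarith) (by linarith)))
      (Or.inl fun p hp => AA_mono l2 le_rfl ((hh p hp).elim id id))
    nlinarith
  · obtain ⟨e3, he3, hT3⟩ := T1_all h5 (h2.trans h3)
    have hy2 : y0 ^ 2 < 4 / 5 := by
      by_contra hc
      push Not at hc
      have k1 : (0.649 : ℝ) ^ 4 * (4 / 5) ^ 2 ≤ (x0 * y0) ^ 4 := by
        calc (0.649 : ℝ) ^ 4 * (4 / 5) ^ 2 ≤ x0 ^ 4 * (y0 ^ 2) ^ 2 := by gcongr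
          _ = _ := by ring
      norm_num at k1
      linarith
    obtain ⟨e2, he2, δ, hδ, hh⟩ := trans2 id_mono hx1 hy1 (fun p hp => by
      by_contra hc
      push Not at hc
      obtain ⟨⟨c1, c2⟩, c3, c4⟩ := hc
      have := hardy h1 h2 hy2 p hp c1 (by rw [HH_eq, c2, mul_zero]) c3 (by rw [HH_eq, c4, mul_zero])
      linarith)
    obtain ⟨ε, hε, l1, l2, l3, l4, l5, l6⟩ : ∃ ε > 0, ε ≤ e1 ∧ ε ≤ e2 ∧ ε < x0 ∧ 2 * ε < 1 - y0 ∧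
        2 * ε < x0 * y0 - 1 / 2 ∧ ε ≤ e3 := by
      refine ⟨min (min e1 (min e2 e3)) (min (x0 / 2) (min ((1 - y0) / 4) ((x0 * y0 - 1 / 2) / 4))), ?_, ?_⟩
      · refine lt_min (lt_min he1 (lt_min he2 he3)) (lt_min (by linarith) (lt_min (by linarith) (by linarith)))
      · have m1 := min_le_left (min e1 (min e2 e3)) (min (x0 / 2) (min ((1 - y0) / 4) ((x0 * y0 - 1 / 2) / 4)))
        have m2 := min_le_right (min e1 (min e2 e3)) (min (x0 / 2) (min ((1 - y0) / 4) ((x0 * y0 - 1 / 2) / 4)))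
        have m3 := m2.trans (min_le_left _ _)
        have m4 := m2.trans (min_le_right _ _)
        have m5 := m4.trans (min_le_left _ _)
        have m6 := m4.trans (min_le_right _ _)
        have m7 := m1.trans (min_le_right _ _)
        refine ⟨m1.trans (min_le_left _ _), m7.trans (min_le_left _ _), ?_, ?_, ?_, m7.trans (min_le_right _ _)⟩ <;> linarith
    refine ⟨ε, hε, by linarith, by linarith, by linarith, by linarith, ?_⟩
    refine est2 hδ hε (by linarith) (by linarith) (by linarith) (by linarith) (by linarith) ?_
      (hT1.mono (Icc_subset_Icc (by linarith) (by linarith)))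
      (Or.inr ⟨hT3.mono (Icc_subset_Icc (by linarith) (by linarith)),
        fun p hp => (hh p hp).imp (AA_mono l2 le_rfl) (AA_mono l2 le_rfl)⟩)
    nlinarith

/-- bounded correlation along a subsequence at all scales -/
def Good (q : ℝ × ℝ) : Prop :=
  ∀ c : ℕ, ∃ C : ℝ≥0∞, C ≠ ∞ ∧ ∃ᶠ k in atTop, E2 (c * rk k) q ≤ C * volume (Metric.ball (0 : ℝ × ℝ) (rk k))

lemma vol_ball_ge (r : ℝ) (hr : 0 < r) : ENNReal.ofReal (r ^ 2) ≤ volume (Metric.ball (0 : ℝ × ℝ) r) := by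
  rw [show (0 : ℝ × ℝ) = (0, 0) from rfl, ← ball_prod_same, Measure.volume_eq_prod, Measure.prod_prod, Real.volume_ball,
    ← ENNReal.ofReal_mul (by positivity)]
  apply ENNReal.ofReal_le_ofReal
  nlinarith

lemma good_rect {a b a' b' C : ℝ} (ha : 0 < a) (hb : b < 1) (ha' : 0 < a') (hb' : b' < 1)
    (hC : ∀ r > 0, ∫⁻ q in Icc a b ×ˢ Icc a' b', E2 r q ≤ ENNReal.ofReal (C * r ^ 2)) :
    ∀ᵐ q ∂(volume.restrict (Icc a b ×ˢ Icc a' b')), Good q := by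
  unfold Good
  rw [ae_all_iff]
  intro c
  have hQ : MeasurableSet (Icc a b ×ˢ Icc a' b') := measurableSet_Icc.prod measurableSet_Icc
  rcases Nat.eq_zero_or_pos c with rfl | hc
  · refine Eventually.of_forall fun q => ⟨0, by simp, Frequently.of_forall fun k => ?_⟩
    have : ∀ q : ℝ × ℝ, E2 0 q = 0 := by
      intro q; unfold E2
      convert measure_empty (μ := PP)
      ext p
      simp only [mem_ofPred_eq, mem_empty_iff_false, iff_false]
      intro h
      exact absurd h.1 (not_lt.2 (abs_nonneg _))
    simp [this]
  have hc' : (0 : ℝ) < c := by exact_mod_cast hc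
  have hm : ∀ r, AEMeasurable (E2 r) (volume.restrict (Icc a b ×ˢ Icc a' b')) := by
    intro r
    refine ⟨_, measurable_measure_prodMk_left (ν := PP) (S2meas ha hb ha' hb' r), ?_⟩
    refine (ae_restrict_of_forall_mem hQ) fun q hq => ?_
    obtain ⟨hq1, hq2⟩ := hq
    unfold E2
    congr 1
    ext p
    simp only [mem_preimage, mem_ofPred_eq]
    tauto
  have hm' : ∀ k : ℕ, AEMeasurable (fun q => (ENNReal.ofReal (rk k ^ 2))⁻¹ * E2 (c * rk k) q)
      (volume.restrict (Icc a b ×ˢ Icc a' b')) := fun k => (hm _).const_mul _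
  have hfat := lintegral_liminf_le' (u := atTop) hm'
  have hbound : ∀ k : ℕ, ∫⁻ q in Icc a b ×ˢ Icc a' b', (ENNReal.ofReal (rk k ^ 2))⁻¹ * E2 (c * rk k) q ≤
      ENNReal.ofReal (C * c ^ 2) := by
    intro k
    have hk := rk_pos k
    rw [lintegral_const_mul' _ _ (by simp; positivity)]
    calc _ ≤ (ENNReal.ofReal (rk k ^ 2))⁻¹ * ENNReal.ofReal (C * (c * rk k) ^ 2) := by
          gcongr; exact hC _ (by positivity)
      _ = _ := by
          rw [← ENNReal.ofReal_inv_of_pos (by positivity), ← ENNReal.ofReal_mul (by positivity)]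
          congr 1; field_simp
  have hlim : ∫⁻ q in Icc a b ×ˢ Icc a' b', liminf (fun k => (ENNReal.ofReal (rk k ^ 2))⁻¹ * E2 (c * rk k) q) atTop ≠ ∞ := by
    refine (lt_of_le_of_lt (hfat.trans ?_) (ENNReal.ofReal_lt_top (r := C * c ^ 2))).ne
    refine (liminf_le_liminf (Eventually.of_forall hbound)).trans ?_
    simp
  have hml : AEMeasurable (fun q => liminf (fun k => (ENNReal.ofReal (rk k ^ 2))⁻¹ * E2 (c * rk k) q) atTop)
      (volume.restrict (Icc a b ×ˢ Icc a' b')) := by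
    refine ⟨fun q => liminf (fun k => (hm' k).mk _ q) atTop, Measurable.liminf (fun k => (hm' k).measurable_mk), ?_⟩
    filter_upwards [ae_all_iff.2 fun k => (hm' k).ae_eq_mk] with q hq
    simp only [hq]
  have hae := ae_lt_top' hml hlim
  filter_upwards [hae] with q hq
  obtain ⟨D, hD1, hD2⟩ := ENNReal.lt_iff_exists_nnreal_btwn.1 hq
  refine ⟨D, ENNReal.coe_ne_top, ?_⟩
  refine (frequently_lt_of_liminf_lt (by isBoundedDefault) hD1).mono fun k hk => ?_
  have hkp := rk_pos k
  have h0 : ENNReal.ofReal (rk k ^ 2) ≠ 0 := by simp; positivity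
  calc E2 (c * rk k) q = ENNReal.ofReal (rk k ^ 2) * ((ENNReal.ofReal (rk k ^ 2))⁻¹ * E2 (c * rk k) q) := by
        rw [← mul_assoc, ENNReal.mul_inv_cancel h0 ENNReal.ofReal_ne_top, one_mul]
    _ ≤ ENNReal.ofReal (rk k ^ 2) * D := by gcongr
    _ = D * ENNReal.ofReal (rk k ^ 2) := mul_comm _ _
    _ ≤ _ := by gcongr; exact vol_ball_ge _ hkp

lemma good_ae : volume {q : ℝ × ℝ | q ∈ regS ∧ ¬ Good q} = 0 := by
  apply measure_null_of_locally_null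
  intro q hq
  obtain ⟨ε, hε, h1, h2, h3, h4, C, hC⟩ := est_loc hq.1
  have h := good_rect h1 h2 h3 h4 hC
  have hQ : MeasurableSet (Icc (q.1 - ε) (q.1 + ε) ×ˢ Icc (q.2 - ε) (q.2 + ε)) :=
    measurableSet_Icc.prod measurableSet_Icc
  rw [ae_restrict_iff' hQ, ae_iff] at h
  refine ⟨_, ?_, h⟩
  have hn : Icc (q.1 - ε) (q.1 + ε) ×ˢ Icc (q.2 - ε) (q.2 + ε) ∈ 𝓝 q := by
    rw [← Prod.mk.eta (p := q)]
    exact prod_mem_nhds (Icc_mem_nhds (by linarith) (by linarith)) (Icc_mem_nhds (by linarith) (by linarith))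
  filter_upwards [mem_nhdsWithin_of_mem_nhds hn, self_mem_nhdsWithin] with z hz hz2
  exact fun hh => hz2.2 (hh hz)

lemma powsum {x : ℝ} (hx0 : 0 < x) (hx1 : x < 1) : Summable (fun j : ℕ => |x ^ j|) := by
  simp only [abs_pow, abs_of_pos hx0]
  exact summable_geometric_of_lt_one hx0.le hx1

/-- pair of series -/
def S2 (c d : ℕ → ℝ) (ω : ℕ → Fin 2) : ℝ × ℝ := (SS c ω, SS d ω)

lemma S2_cont {c d : ℕ → ℝ} (hc : Summable (fun j => |c j|)) (hd : Summable (fun j => |d j|)) :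
    Continuous (S2 c d) := (SS_cont hc).prodMk (SS_cont hd)

lemma S2_join {c d : ℕ → ℝ} (hc : Summable (fun j => |c j|)) (hd : Summable (fun j => |d j|))
    {t : ℕ → ℕ} (ht : Function.Injective t) (u v : ℕ → Fin 2) :
    S2 c d (Function.extend t u v) = S2 (fun j => c (t j)) (fun j => d (t j)) u +
      S2 (indicator (range t)ᶜ c) (indicator (range t)ᶜ d) v := by
  unfold S2
  rw [SS_join hc ht, SS_join hd ht]
  rfl

lemma PiTwo_eq (x y : ℝ) :
    PiTwo 2 (fun i => (i.1 : ℝ)) x y = S2 (fun j => x ^ j) (fun j => y ^ j) := rfl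

lemma S2_E2 {x y : ℝ} (hx0 : 0 < x) (hx1 : x < 1) (hy0 : 0 < y) (hy1 : y < 1) (r : ℝ) :
    PP {p | ‖S2 (fun j => x ^ j) (fun j => y ^ j) p.1 - S2 (fun j => x ^ j) (fun j => y ^ j) p.2‖ < r}
      = E2 r (x, y) := by
  unfold E2
  congr 1
  ext p
  simp only [mem_ofPred_eq]
  rw [FF_eq_SS id_mono (by rwa [abs_of_pos hx0]), FF_eq_SS id_mono (by rwa [abs_of_pos hy0])]
  simp only [S2, Prod.mk_sub_mk, Prod.norm_def, max_lt_iff, Real.norm_eq_abs]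

lemma E2_mono (q : ℝ × ℝ) {r s : ℝ} (h : r ≤ s) : E2 r q ≤ E2 s q := by
  unfold E2
  exact measure_mono fun p hp => ⟨hp.1.trans_le h, hp.2.trans_le h⟩

lemma good_en {q : ℝ × ℝ} (hx0 : 0 < q.1) (hx1 : q.1 < 1) (hy0 : 0 < q.2) (hy1 : q.2 < 1) (hq : Good q) :
    ∃ C : ℝ≥0∞, C ≠ ∞ ∧ ∃ᶠ k in atTop,
      enrg (bern.map (S2 (fun j => q.1 ^ j) (fun j => q.2 ^ j))) (2 * rk k) ≤
        C * volume (Metric.ball (0 : ℝ × ℝ) (rk k)) := by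
  obtain ⟨C, hC, h⟩ := hq 2
  refine ⟨C, hC, h.mono fun k hk => ?_⟩
  rw [enrg_map0 (S2_cont (powsum hx0 hx1) (powsum hy0 hy1)).measurable, S2_E2 hx0 hx1 hy0 hy1]
  exact_mod_cast hk

lemma good_ac {q : ℝ × ℝ} (hx0 : 0 < q.1) (hx1 : q.1 < 1) (hy0 : 0 < q.2) (hy1 : q.2 < 1) (hq : Good q) :
    bern.map (PiTwo 2 (fun i => (i.1 : ℝ)) q.1 q.2) ≪ (volume : Measure (ℝ × ℝ)) := by
  obtain ⟨C, hC, h⟩ := good_en hx0 hx1 hy0 hy1 hq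
  rw [PiTwo_eq]
  exact crit_ac _ _ C hC h

lemma good_cont {x y : ℝ} (hx0 : 0 < x) (hxy : x < y) (hy1 : y < 1) {k : ℕ} (hk : 2 ≤ k)
    (hq : Good (x ^ k, y ^ k)) :
    (∃ f : ℝ × ℝ → ℝ, Continuous f ∧ bern.map (PiTwo 2 (fun i => (i.1 : ℝ)) x y) =
      volume.withDensity (fun z => ENNReal.ofReal (f z))) := by
  have hy0 := hx0.trans hxy
  have hx1 := hxy.trans hy1
  have hk0 : k ≠ 0 := by omega
  have hX0 : 0 < x ^ k := by positivity
  have hX1 : x ^ k < 1 := pow_lt_one₀ hx0.le hx1 hk0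
  have hY0 : 0 < y ^ k := by positivity
  have hY1 : y ^ k < 1 := pow_lt_one₀ hy0.le hy1 hk0
  have sx := powsum hx0 hx1
  have sy := powsum hy0 hy1
  set t : ℕ → ℕ := fun n => k * n with ht
  have hti : Function.Injective t := fun a b h => Nat.eq_of_mul_eq_mul_left (by omega) h
  set t' : ℕ → ℕ := fun n => k * n + 1 with ht'
  have hti' : Function.Injective t' := fun a b h =>
    Nat.eq_of_mul_eq_mul_left (show 0 < k by omega) (Nat.succ_injective h)
  have hdis : ∀ n, t' n ∈ (range t)ᶜ := by
    rintro n ⟨a, ha⟩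
    have ha : k * a = k * n + 1 := ha
    have h1 : k ∣ k * n + 1 := ⟨a, ha.symm⟩
    have h2 : k ∣ 1 := (Nat.dvd_add_right ⟨n, rfl⟩).1 h1
    have := Nat.le_of_dvd one_pos h2
    omega
  set X := S2 (fun j => (x ^ k) ^ j) (fun j => (y ^ k) ^ j) with hX
  set c := indicator (range t)ᶜ (fun j => x ^ j) with hc
  set d := indicator (range t)ᶜ (fun j => y ^ j) with hd
  have sind : ∀ {e : ℕ → ℝ}, Summable (fun j => |e j|) → Summable (fun j => |indicator (range t)ᶜ e j|) := by
    intro e he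
    refine Summable.of_nonneg_of_le (fun j => abs_nonneg _) (fun j => ?_) he
    by_cases h : j ∈ (range t)ᶜ
    · rw [indicator_of_mem h]
    · rw [indicator_of_notMem h, abs_zero]; exact abs_nonneg _
  have sc : Summable (fun j => |c j|) := sind sx
  have sd : Summable (fun j => |d j|) := sind sy
  set W := S2 c d with hW
  have hXm : Measurable X := (S2_cont (powsum hX0 hX1) (powsum hY0 hY1)).measurable
  have hWm : Measurable W := (S2_cont sc sd).measurable
  -- law of X
  obtain ⟨C, hC, h⟩ := good_en (q := (x ^ k, y ^ k)) hX0 hX1 hY0 hY1 hq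
  obtain ⟨g1, hg1, hg1', hg1''⟩ := crit_L2 _ _ C hC h
  -- law of W
  obtain ⟨N, hN⟩ := exists_nat_ge (8 / x)
  obtain ⟨C', hC', h'⟩ := hq N
  have hY : ∀ ω, S2 (fun j => c (t' j)) (fun j => d (t' j)) ω = (x * (X ω).1, y * (X ω).2) := by
    intro ω
    simp only [hX, S2, SS]
    rw [← tsum_mul_left, ← tsum_mul_left]
    congr 1
    · refine tsum_congr fun j => ?_
      rw [hc, indicator_of_mem (hdis j)]
      simp only [ht', pow_succ, pow_mul]; ring
    · refine tsum_congr fun j => ?_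
      rw [hd, indicator_of_mem (hdis j)]
      simp only [ht', pow_succ, pow_mul]; ring
  have hYm : Measurable (S2 (fun j => c (t' j)) (fun j => d (t' j))) :=
    (S2_cont (sc.comp_injective hti') (sd.comp_injective hti')).measurable
  have hWe : ∃ᶠ i in atTop, enrg (bern.map W) (2 * rk i) ≤
      (ENNReal.ofReal (2 ^ Module.finrank ℝ (ℝ × ℝ)) * C') * volume (Metric.ball (0 : ℝ × ℝ) (rk i)) := by
    refine h'.mono fun i hi => ?_
    have hr := rk_pos i
    rw [enrg_map0 hWm, mul_assoc]
    refine (join_energy volume hYm hWm hti' (fun u v => S2_join sc sd hti' u v) (by positivity)).trans ?_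
    gcongr
    refine le_trans ?_ hi
    rw [← S2_E2 hX0 hX1 hY0 hY1]
    refine measure_mono fun p hp => ?_
    have hp : ‖S2 (fun j => c (t' j)) (fun j => d (t' j)) p.1 - S2 (fun j => c (t' j)) (fun j => d (t' j)) p.2‖
      < 4 * (2 * rk i) := hp
    show ‖X p.1 - X p.2‖ < N * rk i
    rw [hY, hY, Prod.norm_def, max_lt_iff] at hp
    rw [Prod.norm_def, max_lt_iff]
    simp only [Prod.mk_sub_mk, Real.norm_eq_abs, ← mul_sub, abs_mul, abs_of_pos hx0, abs_of_pos hy0] at hp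
    simp only [Prod.fst_sub, Prod.snd_sub, Real.norm_eq_abs]
    have key : 8 * rk i ≤ x * (N * rk i) := by
      rw [div_le_iff₀ hx0] at hN
      nlinarith
    constructor
    · refine lt_of_mul_lt_mul_left (lt_of_lt_of_le hp.1 ?_) hx0.le
      linarith
    · refine lt_of_mul_lt_mul_left (lt_of_le_of_lt ?_ (lt_of_lt_of_le hp.2 ?_)) hx0.le
      · gcongr
      · linarith
  obtain ⟨g2, hg2, hg2', hg2''⟩ := crit_L2 _ _ _ (ENNReal.mul_ne_top ENNReal.ofReal_ne_top hC') hWe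
  obtain ⟨f, hf, hfe⟩ := conv_cont volume g1 g2 hg1 hg2 hg1' hg2'
  refine ⟨f, hf, ?_⟩
  rw [← hfe, ← hg1'', ← hg2'', PiTwo_eq, Measure.map_prod_map _ _ hXm hWm,
    Measure.map_map (by fun_prop) (hXm.prodMap hWm)]
  have hPm : Measurable (S2 (fun j => x ^ j) (fun j => y ^ j)) := (S2_cont sx sy).measurable
  conv_lhs => rw [← (join_mp t hti).map_eq]
  rw [Measure.map_map hPm (meas_extend t hti)]
  congr 1
  ext1 p
  simp only [Function.comp_apply, Prod.map]
  rw [S2_join sx sy hti]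
  simp only [ht, pow_mul, hX, hW, hc, hd]

lemma Kaff_int {x y : ℝ} (hx0 : 0 < x) (hx1 : x < 1) (hy0 : 0 < y) (hy1 : y < 1)
    (h : ∃ f : ℝ × ℝ → ℝ, Continuous f ∧ bern.map (PiTwo 2 (fun i => (i.1 : ℝ)) x y) =
      volume.withDensity (fun z => ENNReal.ofReal (f z))) :
    (interior (Kaff 2 (fun i => (i.1 : ℝ)) x y)).Nonempty := by
  obtain ⟨f, hf, hfe⟩ := h
  have hP : Continuous (PiTwo 2 (fun i => (i.1 : ℝ)) x y) := by
    rw [PiTwo_eq]; exact S2_cont (powsum hx0 hx1) (powsum hy0 hy1)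
  have hK : Kaff 2 (fun i => (i.1 : ℝ)) x y = range (PiTwo 2 (fun i => (i.1 : ℝ)) x y) := by
    ext p
    constructor
    · rintro ⟨ω, h⟩; exact ⟨ω, h.symm⟩
    · rintro ⟨ω, h⟩; exact ⟨ω, h.symm⟩
  have hcl : IsClosed (range (PiTwo 2 (fun i => (i.1 : ℝ)) x y)) := (isCompact_range hP).isClosed
  have : IsProbabilityMeasure (bern.map (PiTwo 2 (fun i => (i.1 : ℝ)) x y)) :=
    Measure.isProbabilityMeasure_map hP.measurable.aemeasurable
  rw [hK]
  refine interior_of_density volume _ (IsProbabilityMeasure.ne_zero _) f hf hfe _ hcl ?_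
  rw [Measure.map_apply hP.measurable hcl.measurableSet.compl, preimage_compl, preimage_range, compl_univ,
    measure_empty]

lemma pow_null {N : Set (ℝ × ℝ)} (hN : volume N = 0) {k : ℕ} (hk : 2 ≤ k) :
    volume {q : ℝ × ℝ | 0 < q.1 ∧ 0 < q.2 ∧ (q.1 ^ k, q.2 ^ k) ∈ N} = 0 := by
  have hN' : volume (N ∩ (Ioi 0 ×ˢ Ioi 0)) = 0 := measure_mono_null inter_subset_left hN
  have himg := addHaar_image_eq_zero_of_differentiableOn_of_addHaar_eq_zero (volume : Measure (ℝ × ℝ))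
    (f := fun q : ℝ × ℝ => (q.1 ^ ((k : ℝ)⁻¹), q.2 ^ ((k : ℝ)⁻¹))) (s := N ∩ (Ioi 0 ×ˢ Ioi 0)) ?_ hN'
  · refine measure_mono_null ?_ himg
    rintro ⟨x, y⟩ ⟨hx, hy, h⟩
    refine ⟨(x ^ k, y ^ k), ⟨h, ?_⟩, ?_⟩
    · exact ⟨pow_pos hx k, pow_pos hy k⟩
    · have hk0 : k ≠ 0 := by omega
      simp only
      rw [Real.pow_rpow_inv_natCast (le_of_lt hx) hk0, Real.pow_rpow_inv_natCast (le_of_lt hy) hk0]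
  · rintro ⟨x, y⟩ ⟨_, hx, hy⟩
    have hx : 0 < x := hx
    have hy : 0 < y := hy
    apply DifferentiableAt.differentiableWithinAt
    apply DifferentiableAt.prodMk
    · exact DifferentiableAt.rpow_const (by fun_prop) (Or.inl hx.ne')
    · exact DifferentiableAt.rpow_const (by fun_prop) (Or.inl hy.ne')

lemma regS_pos {q : ℝ × ℝ} (h : q ∈ regS) : 0 < q.1 ∧ q.1 < 1 ∧ 0 < q.2 ∧ q.2 < 1 := by
  have : 0 < q.1 ∧ q.1 < q.2 ∧ q.2 < 1 := by
    rcases h with h | h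
    · exact ⟨h.1, h.2.1, h.2.2.1⟩
    · exact ⟨h.1.1, h.1.2.1, h.1.2.2.1⟩
  exact ⟨this.1, this.2.1.trans this.2.2, this.1.trans this.2.1, this.2.2⟩

lemma regV_ae : ∀ᵐ q : ℝ × ℝ, q ∈ regV → ∃ k : ℕ, 2 ≤ k ∧ Good (q.1 ^ k, q.2 ^ k) := by
  have h : ∀ᵐ q : ℝ × ℝ, ∀ k : ℕ, 2 ≤ k → ¬ (0 < q.1 ∧ 0 < q.2 ∧
      (q.1 ^ k, q.2 ^ k) ∈ {q : ℝ × ℝ | q ∈ regS ∧ ¬ Good q}) := by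
    rw [ae_all_iff]
    intro k
    by_cases hk : 2 ≤ k
    · simp only [hk, true_imp_iff]
      rw [ae_iff]
      simp only [not_not]
      exact pow_null good_ae hk
    · exact Eventually.of_forall fun q h => absurd h hk
  filter_upwards [h] with q hq hV
  obtain ⟨h1, h2, h3, k, hk, hS⟩ := hV
  refine ⟨k, hk, ?_⟩
  by_contra hG
  exact hq k hk ⟨h1, h1.trans h2, hS, hG⟩

/-- For `D = {0,1}`: for a.e. `(γ,λ) ∈ U = S ∪ V` the measure `μ_{γ,λ}` is absolutely
continuous, and for a.e. `(γ,λ) ∈ V` it has a continuous density; in particular for a.e.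
`(γ,λ) ∈ V` the attractor `K_{γ,λ}` has nonempty interior. -/
theorem absolutely_continuous_region
    (ρ : Measure (ℕ → Fin 2)) (hρ : IsBernoulliWith (fun _ => (2 : ℝ≥0∞)⁻¹) ρ) :
    (∀ᵐ q : ℝ × ℝ ∂volume, q ∈ regS ∪ regV →
        (ρ.map (PiTwo 2 (fun i => (i.1 : ℝ)) q.1 q.2)) ≪ (volume : Measure (ℝ × ℝ))) ∧
    (∀ᵐ q : ℝ × ℝ ∂volume, q ∈ regV →
        (∃ f : ℝ × ℝ → ℝ, Continuous f ∧
          ρ.map (PiTwo 2 (fun i => (i.1 : ℝ)) q.1 q.2) =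
            volume.withDensity (fun x => ENNReal.ofReal (f x))) ∧
        (interior (Kaff 2 (fun i => (i.1 : ℝ)) q.1 q.2)).Nonempty) := by
  obtain rfl := bern_unique ρ hρ
  have hV : ∀ᵐ q : ℝ × ℝ ∂volume, q ∈ regV →
        (∃ f : ℝ × ℝ → ℝ, Continuous f ∧
          bern.map (PiTwo 2 (fun i => (i.1 : ℝ)) q.1 q.2) =
            volume.withDensity (fun x => ENNReal.ofReal (f x))) := by
    filter_upwards [regV_ae] with q hq h
    obtain ⟨k, hk, hG⟩ := hq h
    exact good_cont h.1 h.2.1 h.2.2.1 hk hG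
  have hS : ∀ᵐ q : ℝ × ℝ ∂volume, ¬ (q ∈ regS ∧ ¬ Good q) := by
    rw [ae_iff]; simp only [not_not]; exact good_ae
  constructor
  · filter_upwards [hV, hS] with q h1 h2 hq
    rcases hq with hq | hq
    · obtain ⟨a, b, c, d⟩ := regS_pos hq
      exact good_ac a b c d (by by_contra hG; exact h2 ⟨hq, hG⟩)
    · obtain ⟨f, hf, he⟩ := h1 hq
      rw [he]
      exact withDensity_absolutelyContinuous _ _
  · filter_upwards [hV] with q h1 hq
    exact ⟨h1 hq, Kaff_int hq.1 (hq.2.1.trans hq.2.2.1) (hq.1.trans hq.2.1) hq.2.2.1 (h1 hq)⟩
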